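/- Assume f is both squeeze stationary and squash stationary (Almgren frequency monotonicity). Then for every a ∈ U and every r ∈ (0, dist(a, ℝ^m ∖ U)) with H_a(r) > 0, the frequency function N_a is differentiable at r and N_a′(r) ≥ 0. In particular, N_a is nondecreasing on any interval contained in {r ∈ (0, dist(a, ℝ^m ∖ U)) : H_a(r) > 0}. -/

import Mathlib

open MeasureTheory Metric
open scoped RealInnerProductSpace ENNReal NNReal Topology
noncomputable section

/-- The separable Hilbert space `ℓ₂` of square-summable real sequences. -/
abbrev ell2 : Type := lp (fun _ : ℕ => ℝ) 2

/-- Euclidean space `ℝ^m`. -/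
abbrev Em (m : ℕ) : Type := EuclideanSpace ℝ (Fin m)

/-- Squared Hilbert–Schmidt norm `‖A‖²_HS = ∑ i ‖A eᵢ‖²` of `A : ℝ^m →L ℓ₂`. -/
def hsNormSq {m : ℕ} (A : Em m →L[ℝ] ell2) : ℝ :=
  ∑ i : Fin m, ‖A (EuclideanSpace.single i 1)‖ ^ 2

/-- Hilbert–Schmidt inner product `⟨A,B⟩ = ∑ i ⟨A eᵢ, B eᵢ⟩`. -/
def hsInner {m : ℕ} (A B : Em m →L[ℝ] ell2) : ℝ :=
  ∑ i : Fin m, ⟪A (EuclideanSpace.single i 1), B (EuclideanSpace.single i 1)⟫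

/-- Divergence `div X = ∑ i ⟨DX(x) eᵢ, eᵢ⟩` of a vector field `X : ℝ^m → ℝ^m`. -/
def divg {m : ℕ} (X : Em m → Em m) (x : Em m) : ℝ :=
  ∑ i : Fin m, ⟪fderiv ℝ X x (EuclideanSpace.single i 1), EuclideanSpace.single i 1⟫

/-- `f` is squeeze stationary on `U`: for every smooth compactly supported vector field
`X` with support in `U`, the inner variation `t ↦ ∫_U ‖D(f ∘ Φ_t)‖²_HS`,
`Φ_t(x) = x + tX(x)`, has derivative `0` at `t = 0`. -/
def SqueezeStationary {m : ℕ} (U : Set (Em m)) (f : Em m → ell2) : Prop :=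
  ∀ X : Em m → Em m, ContDiff ℝ (⊤ : ℕ∞) X → HasCompactSupport X → tsupport X ⊆ U →
    HasDerivAt
      (fun t : ℝ => ∫ x in U, hsNormSq (fderiv ℝ (fun y => f (y + t • X y)) x)) 0 0

/-- `f` is squash stationary on `U`: for every `C¹` map `Y : U × ℓ₂ → ℓ₂` which is
bounded, has bounded derivative, and with `{x : Y(x,·) ≢ 0}` relatively compact in `U`,
the outer variation `t ↦ ∫_U ‖D(f + tY(·, f(·)))‖²_HS` has derivative `0` at `t = 0`. -/
def SquashStationary {m : ℕ} (U : Set (Em m)) (f : Em m → ell2) : Prop :=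
  ∀ Y : Em m × ell2 → ell2, ContDiff ℝ 1 Y →
    (∃ C, ∀ p, ‖Y p‖ ≤ C) → (∃ C, ∀ p, ‖fderiv ℝ Y p‖ ≤ C) →
    IsCompact (closure {x : Em m | ∃ y, Y (x, y) ≠ 0}) →
    closure {x : Em m | ∃ y, Y (x, y) ≠ 0} ⊆ U →
    HasDerivAt
      (fun t : ℝ =>
        ∫ x in U, hsNormSq (fderiv ℝ (fun z => f z + t • Y (z, f z)) x)) 0 0

/-- Two finite measures on a compact metric space for which balls of equal radius have equal
measure are proportional, as functionals on continuous functions. -/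
theorem integral_mul_measureReal_univ_of_uniform {S : Type*} [MetricSpace S] [CompactSpace S]
    [MeasurableSpace S] [BorelSpace S] (μ ν : Measure S) [IsFiniteMeasure μ] [IsFiniteMeasure ν]
    [ν.IsOpenPosMeasure]
    (hμ : ∀ x y r, μ (ball x r) = μ (ball y r)) (hν : ∀ x y r, ν (ball x r) = ν (ball y r))
    {g : S → ℝ} (hg : Continuous g) :
    μ.real Set.univ * ∫ x, g x ∂ν = ν.real Set.univ * ∫ x, g x ∂μ := by
  rcases isEmpty_or_nonempty S with hS | ⟨⟨x₀⟩⟩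
  · simp [Measure.eq_zero_of_isEmpty]
  have hint : ∀ (κ : Measure S) [IsFiniteMeasure κ] (h : S → ℝ), Continuous h → Integrable h κ := by
    intro κ _ h hh
    exact hh.integrable_of_hasCompactSupport (HasCompactSupport.of_compactSpace _)
  have hswap : ∀ (h : S → ℝ), Continuous h → ∀ r : ℝ,
      ∫ x, (∫ y in ball x r, h y ∂ν) ∂μ = μ.real (ball x₀ r) * ∫ y, h y ∂ν := by
    intro h hh r
    have hm : MeasurableSet {p : S × S | dist p.1 p.2 < r} :=
      (isOpen_lt (by fun_prop) (by fun_prop)).measurableSet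
    have hI : Integrable (Function.uncurry fun x y => (ball x r).indicator h y) (μ.prod ν) := by
      have h2 : Integrable (fun p : S × S => h p.2) (μ.prod ν) := by
        refine Integrable.comp_snd (hint ν h hh) μ
      refine (h2.indicator hm).congr (Filter.Eventually.of_forall fun p => ?_)
      simp [Function.uncurry, Set.indicator, dist_comm]
    calc ∫ x, (∫ y in ball x r, h y ∂ν) ∂μ = ∫ x, (∫ y, (ball x r).indicator h y ∂ν) ∂μ := by
          simp_rw [integral_indicator measurableSet_ball]
      _ = ∫ y, (∫ x, (ball x r).indicator h y ∂μ) ∂ν := integral_integral_swap hI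
      _ = ∫ y, (μ.real (ball x₀ r) * h y) ∂ν := by
          congr 1; ext y
          have : (fun x => (ball x r).indicator h y) = (ball y r).indicator fun _ => h y := by
            ext x; simp [Set.indicator, dist_comm]
          rw [this, integral_indicator measurableSet_ball, setIntegral_const, smul_eq_mul,
            measureReal_def, hμ y x₀, measureReal_def]
      _ = _ := integral_const_mul _ _
  have hνr : ∀ x r, ν.real (ball x r) = ν.real (ball x₀ r) := fun x r => by
    rw [measureReal_def, hν x x₀, measureReal_def]
  by_contra hne
  set T := μ.real Set.univ * ∫ x, g x ∂ν - ν.real Set.univ * ∫ x, g x ∂μ with hT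
  have hT0 : 0 < |T| := abs_pos.2 (sub_ne_zero.2 hne)
  have key : ∀ ε > 0, |T| ≤ ε * (μ.real Set.univ * ν.real Set.univ) := by
    intro ε hε
    obtain ⟨r, hr, hur⟩ := Metric.uniformContinuous_iff.1
      (CompactSpace.uniformContinuous_of_continuous hg) ε hε
    have hpos : 0 < ν.real (ball x₀ r) := by
      rw [measureReal_def]
      exact ENNReal.toReal_pos (isOpen_ball.measure_pos ν ⟨x₀, mem_ball_self hr⟩).ne'
        (measure_ne_top _ _)
    have h1 : ν.real (ball x₀ r) * μ.real Set.univ = μ.real (ball x₀ r) * ν.real Set.univ := by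
      have := hswap (fun _ => 1) continuous_const r
      simp only [integral_const, measureReal_restrict_apply_univ, hνr, smul_eq_mul,
        mul_one] at this
      linarith
    have hmeas : Integrable (fun x => ∫ y in ball x r, g y ∂ν) μ := by
      have hm : MeasurableSet {p : S × S | dist p.1 p.2 < r} :=
        (isOpen_lt (by fun_prop) (by fun_prop)).measurableSet
      have h2 : Integrable (fun p : S × S => g p.2) (μ.prod ν) := (hint ν g hg).comp_snd μ
      refine (h2.indicator hm).integral_prod_left.congr (Filter.Eventually.of_forall fun x => ?_)
      dsimp only
      rw [← integral_indicator measurableSet_ball]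
      congr 1; ext y; simp [Set.indicator, dist_comm]
    have h2 : |∫ x, ((∫ y in ball x r, g y ∂ν) - ν.real (ball x₀ r) * g x) ∂μ|
        ≤ (ε * ν.real (ball x₀ r)) * μ.real Set.univ := by
      rw [← Real.norm_eq_abs]
      refine norm_integral_le_of_norm_le_const (Filter.Eventually.of_forall fun x => ?_)
      have : ν.real (ball x₀ r) * g x = ∫ y in ball x r, g x ∂ν := by
        rw [setIntegral_const, hνr x, smul_eq_mul]
      rw [this, ← integral_sub (hint ν g hg).integrableOn (integrable_const _)]
      rw [← hνr x r]
      refine norm_setIntegral_le_of_norm_le_const (measure_lt_top _ _) fun y hy => ?_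
      exact (hur (mem_ball.1 hy)).le
    rw [integral_sub hmeas ((hint μ g hg).const_mul _), hswap g hg, integral_const_mul] at h2
    have h3 : ν.real (ball x₀ r) * T = ν.real Set.univ *
        (μ.real (ball x₀ r) * ∫ x, g x ∂ν - ν.real (ball x₀ r) * ∫ x, g x ∂μ) := by
      rw [hT]; linear_combination (∫ x, g x ∂ν) * h1
    have h4 : ν.real (ball x₀ r) * |T| ≤ ν.real (ball x₀ r) * (ε * (μ.real Set.univ * ν.real Set.univ)) := by
      rw [← abs_of_pos hpos, ← abs_mul, h3, abs_mul, abs_of_pos hpos, abs_of_nonneg measureReal_nonneg]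
      calc _ ≤ ν.real Set.univ * (ε * ν.real (ball x₀ r) * μ.real Set.univ) := by gcongr
        _ = _ := by ring
    exact le_of_mul_le_mul_left h4 hpos
  have hM : 0 ≤ μ.real Set.univ * ν.real Set.univ := by positivity
  have := key (|T| / (2 * (μ.real Set.univ * ν.real Set.univ + 1))) (by positivity)
  rw [div_mul_eq_mul_div, le_div_iff₀ (by positivity)] at this
  nlinarith

/-- Any two points of the unit sphere are exchanged by a linear isometry. -/
theorem exists_linearIsometryEquiv_apply_eq {E : Type*} [NormedAddCommGroup E]
    [InnerProductSpace ℝ E] [FiniteDimensional ℝ E] {x y : E} (h : ‖x‖ = ‖y‖) :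
    ∃ T : E ≃ₗᵢ[ℝ] E, T x = y :=
  ⟨_, Submodule.reflection_sub h⟩

open scoped Pointwise in
theorem toSphere_ball_eq {m : ℕ} (x y : sphere (0 : Em m) 1) (r : ℝ) :
    (volume : Measure (Em m)).toSphere (ball x r) = (volume : Measure (Em m)).toSphere (ball y r) := by
  obtain ⟨T, hT⟩ := exists_linearIsometryEquiv_apply_eq
    (x := (y : Em m)) (y := (x : Em m)) (by simp)
  rw [Measure.toSphere_apply' _ measurableSet_ball, Measure.toSphere_apply' _ measurableSet_ball,
    Subtype.image_ball, Subtype.image_ball]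
  congr 1
  rw [← T.measurePreserving.measure_preimage_equiv (f := T.toHomeomorph.toMeasurableEquiv)]
  congr 1
  ext z
  simp only [Set.mem_preimage, Set.mem_smul, Set.mem_inter_iff]
  constructor
  · rintro ⟨t, ht, w, ⟨hw1, hw2⟩, hz⟩
    refine ⟨t, ht, T.symm w, ⟨?_, ?_⟩, ?_⟩
    · rw [← hT] at hw1
      rw [mem_ball] at hw1 ⊢
      rw [← T.dist_map]; simpa using hw1
    · simpa using hw2
    · rw [← map_smul, hz]; exact T.symm_apply_apply z
  · rintro ⟨t, ht, w, ⟨hw1, hw2⟩, rfl⟩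
    refine ⟨t, ht, T w, ⟨?_, ?_⟩, (map_smul T t w).symm⟩
    · rw [← hT]; simpa using hw1
    · simpa using hw2

theorem hausdorffMeasure_sphere_ball_eq {m : ℕ} (d : ℝ) (x y : sphere (0 : Em m) 1) (r : ℝ) :
    (μH[d] : Measure (sphere (0 : Em m) 1)) (ball x r) = μH[d] (ball y r) := by
  obtain ⟨T, hT⟩ := exists_linearIsometryEquiv_apply_eq
    (x := (x : Em m)) (y := (y : Em m)) (by simp)
  let e : sphere (0 : Em m) 1 ≃ᵢ sphere (0 : Em m) 1 :=
    { toFun := fun z => ⟨T z, by simp⟩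
      invFun := fun z => ⟨T.symm z, by simp⟩
      left_inv := fun z => by simp
      right_inv := fun z => by simp
      isometry_toFun := fun a b => by simp [Subtype.edist_eq] }
  have : e '' ball x r = ball y r := by
    rw [e.image_ball]
    congr 1
    exact Subtype.ext hT
  rw [← this, e.hausdorffMeasure_image]

/-- On the unit sphere, Hausdorff measure is proportional to the surface measure of polar
coordinates (with constant `0` encoding the degenerate non-finite case). -/
theorem exists_integral_hausdorffMeasure_sphere_eq {m : ℕ} (hm : 2 ≤ m) (d : ℝ) :
    ∃ c : ℝ, 0 ≤ c ∧ ∀ g : sphere (0 : Em m) 1 → ℝ, Continuous g →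
      ∫ x, g x ∂(μH[d] : Measure (sphere (0 : Em m) 1)) =
        c * ∫ x, g x ∂(volume : Measure (Em m)).toSphere := by
  have : Nontrivial (Em m) := by
    have : Nonempty (Fin m) := ⟨⟨0, by omega⟩⟩
    infer_instance
  set S := sphere (0 : Em m) 1
  set ν := (volume : Measure (Em m)).toSphere
  have hν0 : 0 < ν.real Set.univ := by
    rw [measureReal_def]
    exact ENNReal.toReal_pos (Measure.measure_univ_ne_zero.2 (Measure.toSphere_ne_zero _)) (measure_ne_top _ _)
  by_cases hfin : (μH[d] : Measure S) Set.univ = ∞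
  · refine ⟨0, le_rfl, fun g hg => ?_⟩
    rw [zero_mul]
    by_cases hgi : Integrable g (μH[d] : Measure S)
    swap
    · exact integral_undef hgi
    have hball : ∀ (x : S) (r : ℝ), 0 < r → (μH[d] : Measure S) (ball x r) = ∞ := by
      intro x r hr
      by_contra hne
      have hcov := isCompact_univ.elim_finite_subcover (fun x : S => ball x r) (fun _ => isOpen_ball)
        (fun y _ => Set.mem_iUnion.2 ⟨y, mem_ball_self hr⟩)
      obtain ⟨t, ht⟩ := hcov
      have := (measure_mono (μ := (μH[d] : Measure S)) ht).trans (measure_biUnion_finset_le t _)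
      rw [hfin, top_le_iff, ENNReal.sum_eq_top] at this
      obtain ⟨y, -, hy⟩ := this
      exact hne ((hausdorffMeasure_sphere_ball_eq d x y r).trans hy)
    have hg0 : ∀ x, g x = 0 := by
      intro x
      by_contra hx
      have hx' : 0 < ‖g x‖ := norm_pos_iff.2 hx
      have hopen : {y | ‖g x‖ / 2 < ‖g y‖} ∈ 𝓝 x :=
        (isOpen_lt continuous_const hg.norm).mem_nhds (half_lt_self hx')
      obtain ⟨r, hr, hsub⟩ := Metric.mem_nhds_iff.1 hopen
      have h1 := hgi.measure_norm_ge_lt_top (half_pos hx')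
      have h2 := measure_mono (μ := (μH[d] : Measure S))
        (hsub.trans (fun y (hy : ‖g x‖ / 2 < ‖g y‖) => (le_of_lt hy : ‖g x‖ / 2 ≤ ‖g y‖)))
      rw [hball x r hr] at h2
      exact absurd h1 (not_lt.2 h2)
    simp [hg0]
  · have : IsFiniteMeasure (μH[d] : Measure S) := ⟨lt_top_iff_ne_top.2 hfin⟩
    refine ⟨(μH[d] : Measure S).real Set.univ / ν.real Set.univ, by positivity, fun g hg => ?_⟩
    have := integral_mul_measureReal_univ_of_uniform (μH[d] : Measure S) ν
      (hausdorffMeasure_sphere_ball_eq d) toSphere_ball_eq hg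
    rw [div_mul_eq_mul_div, this]
    exact (mul_div_cancel_left₀ _ hν0.ne').symm

open scoped Pointwise in
/-- The `(m-1)`-dimensional Hausdorff integral over a sphere, as an integral over the unit
sphere. -/
theorem setIntegral_sphere_hausdorffMeasure {m : ℕ} (hm : 2 ≤ m) (g : Em m → ℝ) (a : Em m)
    {ρ : ℝ} (hρ : 0 < ρ) :
    ∫ x in sphere a ρ, g x ∂(μH[((m : ℝ) - 1)] : Measure (Em m)) =
      ρ ^ (m - 1) * ∫ ω : sphere (0 : Em m) 1, g (a + ρ • (ω : Em m)) ∂μH[((m : ℝ) - 1)] := by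
  have hd : (0 : ℝ) ≤ (m : ℝ) - 1 := by
    have : (2 : ℝ) ≤ m := by exact_mod_cast hm
    linarith
  let e : Em m ≃ₜ Em m := (Homeomorph.smulOfNeZero ρ hρ.ne').trans (Homeomorph.addLeft a)
  have he : ∀ x, e x = a + ρ • x := fun x => rfl
  have hmap : (μH[((m : ℝ) - 1)] : Measure (Em m)) =
      ENNReal.ofReal (ρ ^ (m - 1)) • Measure.map e μH[((m : ℝ) - 1)] := by
    ext s hs
    rw [Measure.smul_apply, Measure.map_apply e.continuous.measurable hs]
    have h1 : s = (IsometryEquiv.addLeft a) '' (ρ • (e ⁻¹' s)) := by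
      ext x
      simp only [Set.mem_image, Set.mem_smul_set, Set.mem_preimage]
      constructor
      · intro hx
        refine ⟨x - a, ⟨ρ⁻¹ • (x - a), ?_, ?_⟩, ?_⟩
        · rw [he, smul_inv_smul₀ hρ.ne']; simpa using hx
        · rw [smul_inv_smul₀ hρ.ne']
        · simp
      · rintro ⟨_, ⟨y, hy, rfl⟩, rfl⟩
        exact hy
    conv_lhs => rw [h1]
    rw [IsometryEquiv.hausdorffMeasure_image, Measure.hausdorffMeasure_smul₀ hd hρ.ne',
      ENNReal.smul_def, smul_eq_mul, smul_eq_mul]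
    congr 1
    rw [show ((m : ℝ) - 1) = ((m - 1 : ℕ) : ℝ) by push_cast [show 1 ≤ m by omega]; ring,
      NNReal.rpow_natCast, ENNReal.ofReal, Real.toNNReal_pow hρ.le]
    congr 2
    ext
    simp [abs_of_pos hρ, hρ.le]
  have hpre : e ⁻¹' sphere a ρ = sphere 0 1 := by
    ext x
    simp only [Set.mem_preimage, he, mem_sphere_iff_norm, add_sub_cancel_left, norm_smul,
      Real.norm_eq_abs, abs_of_pos hρ, sub_zero]
    constructor
    · intro h; exact mul_left_cancel₀ hρ.ne' (by linarith)
    · intro h; rw [h, mul_one]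
  have hval : (μH[((m : ℝ) - 1)] : Measure (Em m)).restrict (sphere 0 1) =
      Measure.map ((↑) : sphere (0 : Em m) 1 → Em m) μH[((m : ℝ) - 1)] := by
    rw [isometry_subtype_coe.map_hausdorffMeasure (Or.inl hd), Subtype.range_coe]
  conv_lhs => rw [hmap]
  rw [Measure.restrict_smul, integral_smul_measure,
    e.measurableEmbedding.setIntegral_map, hpre, hval,
    (MeasurableEmbedding.subtype_coe isClosed_sphere.measurableSet).integral_map,
    ENNReal.toReal_ofReal (by positivity), smul_eq_mul]
  rfl

/-- Hausdorff integrals over spheres are proportional to those of polar coordinates. -/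
theorem exists_setIntegral_sphere_eq {m : ℕ} (hm : 2 ≤ m) :
    ∃ c : ℝ, 0 ≤ c ∧ ∀ (g : Em m → ℝ) (a : Em m) (ρ : ℝ), 0 < ρ → ContinuousOn g (sphere a ρ) →
      ∫ x in sphere a ρ, g x ∂(μH[((m : ℝ) - 1)] : Measure (Em m)) =
        c * (ρ ^ (m - 1) * ∫ ω : sphere (0 : Em m) 1, g (a + ρ • (ω : Em m))
          ∂(volume : Measure (Em m)).toSphere) := by
  obtain ⟨c, hc, h⟩ := exists_integral_hausdorffMeasure_sphere_eq hm ((m : ℝ) - 1)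
  refine ⟨c, hc, fun g a ρ hρ hg => ?_⟩
  rw [setIntegral_sphere_hausdorffMeasure hm g a hρ, h]
  · ring
  · refine hg.comp_continuous (by fun_prop) fun ω => ?_
    simp [norm_smul, abs_of_pos hρ]

/-- Integration in polar coordinates around `a`. -/
theorem integral_eq_integral_polar {m : ℕ} (hm : 2 ≤ m) (a : Em m) {F : Em m → ℝ}
    (hF : Integrable F) :
    ∫ x, F x = ∫ s in Set.Ioi (0 : ℝ), s ^ (m - 1) * ∫ ω : sphere (0 : Em m) 1,
      F (a + s • (ω : Em m)) ∂(volume : Measure (Em m)).toSphere := by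
  have : Nontrivial (Em m) := by
    have : Nonempty (Fin m) := ⟨⟨0, by omega⟩⟩
    infer_instance
  have hFa : Integrable (fun x => F (a + x)) := hF.comp_add_left a
  rw [← integral_add_left_eq_self F a]
  set ν := (volume : Measure (Em m)).toSphere
  have hmp := (volume : Measure (Em m)).measurePreserving_homeomorphUnitSphereProd
  have hme := (homeomorphUnitSphereProd (Em m)).measurableEmbedding
  let Φ : sphere (0 : Em m) 1 × Set.Ioi (0 : ℝ) → ℝ := fun p => F (a + (p.2 : ℝ) • (p.1 : Em m))
  have hΦ : ∀ x : ({0}ᶜ : Set (Em m)), Φ (homeomorphUnitSphereProd (Em m) x) = F (a + x) := by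
    intro x
    have hx : ‖(x : Em m)‖ ≠ 0 := norm_ne_zero_iff.2 x.2
    simp only [Φ, homeomorphUnitSphereProd_apply_snd_coe, homeomorphUnitSphereProd_apply_fst_coe]
    rw [smul_inv_smul₀ hx]
  have hΦi : Integrable Φ (ν.prod (Measure.volumeIoiPow (Module.finrank ℝ (Em m) - 1))) := by
    rw [← hmp.integrable_comp_emb hme]
    have h1 : Integrable (fun x : ({0}ᶜ : Set (Em m)) => F (a + x))
        (Measure.comap (↑) (volume : Measure (Em m))) :=
      (integrableOn_iff_comap_subtypeVal (measurableSet_singleton _).compl).1 hFa.integrableOn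
    exact h1.congr (Filter.Eventually.of_forall fun x => (hΦ x).symm)
  calc ∫ x, F (a + x) = ∫ x : ({0}ᶜ : Set (Em m)), F (a + x) ∂(Measure.comap Subtype.val volume) := by
        rw [integral_subtype_comap (measurableSet_singleton _).compl fun x => F (a + x),
          restrict_compl_singleton]
    _ = ∫ x : ({0}ᶜ : Set (Em m)), Φ (homeomorphUnitSphereProd (Em m) x)
          ∂(Measure.comap Subtype.val volume) := by simp_rw [hΦ]
    _ = ∫ p, Φ p ∂(ν.prod (Measure.volumeIoiPow (Module.finrank ℝ (Em m) - 1))) :=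
        hmp.integral_comp hme Φ
    _ = ∫ s : Set.Ioi (0 : ℝ), (∫ ω, Φ (ω, s) ∂ν)
          ∂(Measure.volumeIoiPow (Module.finrank ℝ (Em m) - 1)) := integral_prod_symm _ hΦi
    _ = _ := by
        simp only [Measure.volumeIoiPow, ENNReal.ofReal, finrank_euclideanSpace, Fintype.card_fin]
        rw [integral_withDensity_eq_integral_smul
            (measurable_subtype_coe.pow_const _).real_toNNReal,
          integral_subtype_comap measurableSet_Ioi fun s : ℝ => Real.toNNReal (s ^ (m - 1)) •
            ∫ ω : sphere (0 : Em m) 1, F (a + s • (ω : Em m)) ∂ν]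
        refine setIntegral_congr_fun measurableSet_Ioi fun s hs => ?_
        rw [NNReal.smul_def, Real.coe_toNNReal _ (pow_nonneg (le_of_lt hs) _), smul_eq_mul]

section HilbertSchmidt

variable {m : ℕ}

theorem hsNormSq_nonneg (A : Em m →L[ℝ] ell2) : 0 ≤ hsNormSq A :=
  Finset.sum_nonneg fun _ _ => by positivity

theorem continuous_hsNormSq : Continuous (hsNormSq : (Em m →L[ℝ] ell2) → ℝ) := by
  unfold hsNormSq; fun_prop

theorem ContinuousOn.hsInner {X : Type*} [TopologicalSpace X] {s : Set X}
    {A B : X → (Em m →L[ℝ] ell2)} (hA : ContinuousOn A s) (hB : ContinuousOn B s) :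
    ContinuousOn (fun x => hsInner (A x) (B x)) s := by
  unfold _root_.hsInner
  refine continuousOn_finsetSum _ fun i _ => ?_
  exact (hA.clm_apply continuousOn_const).inner (𝕜 := ℝ) (hB.clm_apply continuousOn_const)

theorem ContinuousOn.hsNormSq {X : Type*} [TopologicalSpace X] {s : Set X}
    {A : X → (Em m →L[ℝ] ell2)} (hA : ContinuousOn A s) :
    ContinuousOn (fun x => hsNormSq (A x)) s :=
  continuous_hsNormSq.comp_continuousOn hA

theorem hsNormSq_le (A : Em m →L[ℝ] ell2) : hsNormSq A ≤ m * ‖A‖ ^ 2 := by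
  unfold hsNormSq
  calc _ ≤ ∑ _i : Fin m, ‖A‖ ^ 2 := by
        refine Finset.sum_le_sum fun i _ => ?_
        gcongr
        simpa using A.le_opNorm (EuclideanSpace.single i (1 : ℝ))
    _ = _ := by simp

theorem abs_hsInner_le (A B : Em m →L[ℝ] ell2) : |hsInner A B| ≤ m * (‖A‖ * ‖B‖) := by
  unfold hsInner
  calc _ ≤ ∑ i : Fin m, |⟪A (EuclideanSpace.single i (1 : ℝ)), B (EuclideanSpace.single i (1 : ℝ))⟫| :=
        Finset.abs_sum_le_sum_abs _ _
    _ ≤ ∑ _i : Fin m, ‖A‖ * ‖B‖ := by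
        refine Finset.sum_le_sum fun i _ => (abs_real_inner_le_norm _ _).trans ?_
        gcongr
        · simpa using A.le_opNorm (EuclideanSpace.single i (1 : ℝ))
        · simpa using B.le_opNorm (EuclideanSpace.single i (1 : ℝ))
    _ = _ := by simp

theorem hsNormSq_add_smul (A B : Em m →L[ℝ] ell2) (t : ℝ) :
    hsNormSq (A + t • B) = hsNormSq A + t * (2 * hsInner A B) + t ^ 2 * hsNormSq B := by
  unfold hsNormSq hsInner
  simp only [Finset.mul_sum, ← Finset.sum_add_distrib]
  refine Finset.sum_congr rfl fun i _ => ?_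
  simp only [add_apply, smul_apply]
  rw [norm_add_sq_real, inner_smul_right, norm_smul, mul_pow, Real.norm_eq_abs, sq_abs]
  ring

end HilbertSchmidt

/-- A function continuous on an open set and vanishing off a compact subset is integrable. -/
theorem integrableOn_of_continuousOn_of_eq_zero {m : ℕ} {U K : Set (Em m)}
    (hU : IsOpen U) (hK : IsCompact K) (hKU : K ⊆ U) {g : Em m → ℝ} (hg : ContinuousOn g U)
    (h0 : ∀ x ∈ U \ K, g x = 0) : IntegrableOn g U :=
  ((hg.mono hKU).integrableOn_compact hK).of_forall_sdiff_eq_zero hU.measurableSet h0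

theorem contDiffOn_one_of_hasFDerivAt {m : ℕ} {U : Set (Em m)} (hU : IsOpen U)
    {f : Em m → ell2} {f' : Em m → (Em m →L[ℝ] ell2)}
    (hf : ∀ x ∈ U, HasFDerivAt f (f' x) x) (hf'c : ContinuousOn f' U) : ContDiffOn ℝ 1 f U := by
  rw [show (1 : WithTop ℕ∞) = 0 + 1 by simp, contDiffOn_succ_iff_fderiv_of_isOpen hU,
    contDiffOn_zero]
  exact ⟨fun x hx => (hf x hx).differentiableAt.differentiableWithinAt, by simp,
    hf'c.congr fun x hx => (hf x hx).fderiv⟩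

/-- First outer variation of the Dirichlet energy. -/
theorem SquashStationary.integral_hsInner_eq_zero {m : ℕ} {U : Set (Em m)} (hU : IsOpen U)
    {f : Em m → ell2} {f' : Em m → (Em m →L[ℝ] ell2)}
    (hf : ∀ x ∈ U, HasFDerivAt f (f' x) x) (hf'c : ContinuousOn f' U)
    (hfin : IntegrableOn (fun x => hsNormSq (f' x)) U volume)
    (hsquash : SquashStationary U f) {u : Em m → ell2} (hu : ContDiff ℝ 1 u)
    (huc : HasCompactSupport u) (huU : tsupport u ⊆ U) :
    ∫ x in U, hsInner (f' x) (fderiv ℝ u x) = 0 := by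
  have hset : {x : Em m | ∃ y : ell2, (fun p : Em m × ell2 => u p.1) (x, y) ≠ 0} =
      Function.support u := by
    ext x; simp [Function.mem_support]
  have hdu : Continuous (fderiv ℝ u) := hu.continuous_fderiv (by norm_num)
  obtain ⟨C, hC⟩ := huc.exists_bound_of_continuous hu.continuous
  obtain ⟨C', hC'⟩ := (huc.fderiv ℝ).exists_bound_of_continuous hdu
  have h := hsquash (fun p => u p.1) (hu.comp contDiff_fst) ⟨C, fun p => hC _⟩ ?_
    (by rw [hset]; exact huc) (by rw [hset]; exact huU)
  swap
  · refine ⟨C' * ‖ContinuousLinearMap.fst ℝ (Em m) ell2‖, fun p => ?_⟩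
    have : HasFDerivAt (fun p : Em m × ell2 => u p.1)
        ((fderiv ℝ u p.1).comp (ContinuousLinearMap.fst ℝ (Em m) ell2)) p :=
      ((hu.differentiable (by norm_num)) p.1).hasFDerivAt.comp p hasFDerivAt_fst
    rw [this.fderiv]
    refine (ContinuousLinearMap.opNorm_comp_le _ _).trans ?_
    gcongr
    exact hC' _
  have hzero : ∀ x ∈ U \ tsupport u, fderiv ℝ u x = 0 := fun x hx =>
    fderiv_of_notMem_tsupport _ hx.2
  have hi1 : IntegrableOn (fun x => hsInner (f' x) (fderiv ℝ u x)) U :=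
    integrableOn_of_continuousOn_of_eq_zero hU huc huU
      (hf'c.hsInner hdu.continuousOn)
      (fun x hx => by rw [hzero x hx]; simp [hsInner])
  have hi2 : IntegrableOn (fun x => hsNormSq (fderiv ℝ u x)) U :=
    integrableOn_of_continuousOn_of_eq_zero hU huc huU
      hdu.continuousOn.hsNormSq (fun x hx => by rw [hzero x hx]; simp [hsNormSq])
  have hE : (fun t : ℝ => ∫ x in U, hsNormSq (fderiv ℝ (fun z => f z + t • u z) x)) =
      fun t => (∫ x in U, hsNormSq (f' x)) + t * (2 * ∫ x in U, hsInner (f' x) (fderiv ℝ u x)) +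
        t ^ 2 * ∫ x in U, hsNormSq (fderiv ℝ u x) := by
    ext t
    rw [← integral_const_mul, ← integral_const_mul, ← integral_const_mul, ← integral_add hfin,
      ← integral_add]
    · refine setIntegral_congr_fun hU.measurableSet fun x hx => ?_
      have : HasFDerivAt (fun z => f z + t • u z) (f' x + t • fderiv ℝ u x) x :=
        (hf x hx).add (((hu.differentiable (by norm_num)) x).hasFDerivAt.const_smul t)
      simp only [this.fderiv, hsNormSq_add_smul]
    · exact hfin.add ((hi1.const_mul 2).const_mul t)
    · exact hi2.const_mul _
    · exact (hi1.const_mul 2).const_mul t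
  rw [hE] at h
  have h2 : HasDerivAt (fun t : ℝ => (∫ x in U, hsNormSq (f' x)) +
      t * (2 * ∫ x in U, hsInner (f' x) (fderiv ℝ u x)) +
        t ^ 2 * ∫ x in U, hsNormSq (fderiv ℝ u x))
      (2 * ∫ x in U, hsInner (f' x) (fderiv ℝ u x)) 0 := by
    have := (((hasDerivAt_id (0 : ℝ)).mul_const
      (2 * ∫ x in U, hsInner (f' x) (fderiv ℝ u x))).const_add
        (∫ x in U, hsNormSq (f' x))).add
      (((hasDerivAt_id (0 : ℝ)).pow 2).mul_const (∫ x in U, hsNormSq (fderiv ℝ u x)))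
    refine this.congr_deriv ?_
    simp
  linarith [h.unique h2]

section Det

variable {m : ℕ}

theorem ContinuousLinearMap.det_eq_matrix_det (B : Em m →L[ℝ] Em m) :
    B.det = (Matrix.of fun i j : Fin m => (B (EuclideanSpace.single j 1)) i).det := by
  rw [ContinuousLinearMap.det, ← LinearMap.det_toMatrix (EuclideanSpace.basisFun (Fin m) ℝ).toBasis]
  congr 1

theorem differentiable_det : Differentiable ℝ fun B : Em m →L[ℝ] Em m => B.det := by
  have : (fun B : Em m →L[ℝ] Em m => B.det) = fun B => ∑ σ : Equiv.Perm (Fin m),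
      ((Equiv.Perm.sign σ : ℤ) : ℝ) * ∏ i, (B (EuclideanSpace.single i 1)) (σ i) := by
    ext B
    rw [ContinuousLinearMap.det_eq_matrix_det, Matrix.det_apply']
    simp
  rw [this]
  fun_prop

theorem hasDerivAt_det_one_add_smul (B : Em m →L[ℝ] Em m) :
    HasDerivAt (fun t : ℝ => (1 + t • B).det)
      (∑ i : Fin m, ⟪B (EuclideanSpace.single i 1), EuclideanSpace.single i (1 : ℝ)⟫) 0 := by
  set M : Matrix (Fin m) (Fin m) ℝ := Matrix.of fun i j => (B (EuclideanSpace.single j 1)) i with hM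
  have h1 : (fun t : ℝ => (1 + t • B).det) = fun t => (1 + t • M).det := by
    ext t
    rw [ContinuousLinearMap.det_eq_matrix_det]
    congr 1
    ext i j
    simp [hM, Matrix.one_apply]
  have h2 : ∑ i : Fin m, ⟪B (EuclideanSpace.single i 1), EuclideanSpace.single i (1 : ℝ)⟫ =
      M.trace := by
    simp [Matrix.trace, hM, EuclideanSpace.inner_single_right]
  rw [h1, h2]
  rw [funext fun t : ℝ => Matrix.det_one_add_smul t M]
  set p := (Matrix.det (1 + (Polynomial.X : Polynomial ℝ) • M.map Polynomial.C)).divX.divX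
  have := (((hasDerivAt_id (0 : ℝ)).const_mul M.trace).const_add 1).add
    ((p.hasDerivAt 0).mul ((hasDerivAt_id (0 : ℝ)).pow 2))
  refine this.congr_deriv ?_
  simp

theorem exists_abs_det_one_add_sub_one_le :
    ∃ δ > 0, ∃ C ≥ 0, ∀ B : Em m →L[ℝ] Em m, ‖B‖ < δ → |(1 + B).det - 1| ≤ C * ‖B‖ := by
  have h := ((differentiable_det (m := m)) 1).isBigO_sub
  obtain ⟨C, hC, hb⟩ := h.exists_nonneg
  obtain ⟨δ, hδ, hball⟩ := Metric.eventually_nhds_iff.1 hb.bound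
  refine ⟨δ, hδ, C, hC, fun B hB => ?_⟩
  have hone : (1 : Em m →L[ℝ] Em m).det = 1 := by
    simp [ContinuousLinearMap.det]
  have := hball (y := 1 + B) (by simpa [dist_eq_norm] using hB)
  simpa [hone] using this

end Det

/-- A small perturbation of the identity by a Lipschitz field is bijective. -/
theorem bijective_add_smul {m : ℕ} {X : Em m → Em m} {L : ℝ≥0} (hX : LipschitzWith L X)
    {t : ℝ} (ht : |t| * L < 1) : Function.Bijective fun x => x + t • X x := by
  have hlip : ∀ z : Em m, ContractingWith (‖t‖₊ * L) fun x => z - t • X x := by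
    intro z
    refine ⟨by rw [← NNReal.coe_lt_coe]; simpa using ht, ?_⟩
    refine LipschitzWith.of_dist_le_mul fun x y => ?_
    have := hX.dist_le_mul x y
    rw [dist_eq_norm] at this ⊢
    rw [show z - t • X x - (z - t • X y) = -(t • (X x - X y)) by rw [smul_sub]; abel, norm_neg,
      norm_smul]
    push_cast
    rw [mul_assoc]
    gcongr
  constructor
  · intro x y hxy
    have hx : Function.IsFixedPt (fun w => (x + t • X x) - t • X w) x := by
      simp [Function.IsFixedPt]
    have hy : Function.IsFixedPt (fun w => (x + t • X x) - t • X w) y := by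
      simp only [Function.IsFixedPt]
      rw [show x + t • X x = y + t • X y from hxy]
      simp
    exact (hlip _).fixedPoint_unique' hx hy
  · intro z
    have := (hlip z).fixedPoint_isFixedPt
    refine ⟨ContractingWith.fixedPoint _ (hlip z), ?_⟩
    simp only [Function.IsFixedPt] at this
    exact (eq_sub_iff_add_eq.1 this.symm)

/-- A bijection fixing the complement of `s` pointwise preserves `s`. -/
theorem Function.Bijective.mem_iff_of_fix_compl {α : Type*} {Φ : α → α}
    (hΦ : Function.Bijective Φ) {s : Set α} (hfix : ∀ x ∉ s, Φ x = x) (x : α) :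
    Φ x ∈ s ↔ x ∈ s := by
  constructor
  · intro h
    by_contra hx
    exact hx (by rwa [hfix x hx] at h)
  · intro h
    by_contra hx
    exact hx (by rwa [hΦ.1 (hfix _ hx)])

theorem norm_comp_sq_bound {m : ℕ} {A : Em m →L[ℝ] ell2} {B : Em m →L[ℝ] Em m} {MA MB : ℝ}
    (hA : ‖A‖ ≤ MA) (hB : ‖B‖ ≤ MB) :
    |hsInner A (A.comp B)| ≤ m * (MA * (MA * MB)) ∧ hsNormSq (A.comp B) ≤ m * (MA * MB) ^ 2 ∧
      hsNormSq A ≤ m * MA ^ 2 := by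
  have hMA : 0 ≤ MA := (norm_nonneg _).trans hA
  have hMB : 0 ≤ MB := (norm_nonneg _).trans hB
  have hc : ‖A.comp B‖ ≤ MA * MB :=
    (ContinuousLinearMap.opNorm_comp_le _ _).trans (by gcongr)
  refine ⟨(abs_hsInner_le _ _).trans (by gcongr), (hsNormSq_le _).trans (by gcongr),
    (hsNormSq_le _).trans (by gcongr)⟩

/-- The integrand of the difference quotient of the inner variation. -/
def squeezeQuotient {m : ℕ} (A : Em m →L[ℝ] ell2) (B : Em m →L[ℝ] Em m) (t : ℝ) : ℝ :=
  2 * hsInner A (A.comp B) + t * hsNormSq (A.comp B) - hsNormSq A * (((1 + t • B).det - 1) / t)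

theorem squeezeQuotient_spec {m : ℕ} (A : Em m →L[ℝ] ell2) (B : Em m →L[ℝ] Em m) {t : ℝ}
    (ht : t ≠ 0) :
    hsNormSq (A.comp (1 + t • B)) =
      (1 + t • B).det * hsNormSq A + t * squeezeQuotient A B t := by
  have h1 : A.comp (1 + t • B) = A + t • A.comp B := by
    ext x; simp
  rw [h1, hsNormSq_add_smul, squeezeQuotient]
  field_simp
  ring

/-- First inner variation of the Dirichlet energy. -/
theorem SqueezeStationary.integral_eq_zero {m : ℕ} {U : Set (Em m)} (hU : IsOpen U)
    {f : Em m → ell2} {f' : Em m → (Em m →L[ℝ] ell2)}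
    (hf : ∀ x ∈ U, HasFDerivAt f (f' x) x) (hf'c : ContinuousOn f' U)
    (hfin : IntegrableOn (fun x => hsNormSq (f' x)) U volume)
    (hsqueeze : SqueezeStationary U f) {X : Em m → Em m} (hX : ContDiff ℝ (⊤ : ℕ∞) X)
    (hXc : HasCompactSupport X) (hXU : tsupport X ⊆ U) :
    ∫ x in U, (2 * hsInner (f' x) ((f' x).comp (fderiv ℝ X x)) - hsNormSq (f' x) * divg X x) = 0 := by
  have h := hsqueeze X hX hXc hXU
  set K := tsupport X with hKdef
  have hK : IsCompact K := hXc
  have hKm : MeasurableSet K := hK.isClosed.measurableSet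
  obtain ⟨L, hL⟩ := hX.lipschitzWith_of_hasCompactSupport hXc (by simp)
  have hdX : Continuous (fderiv ℝ X) := hX.continuous_fderiv (by simp)
  have hXd : ∀ x, HasFDerivAt X (fderiv ℝ X x) x := fun x =>
    (hX.differentiable (by simp) x).hasFDerivAt
  obtain ⟨MB, hMB⟩ := (hXc.fderiv ℝ).exists_bound_of_continuous hdX
  obtain ⟨MA, hMA⟩ := hK.exists_bound_of_continuousOn (hf'c.mono hXU)
  have hdXK : ∀ x ∉ K, fderiv ℝ X x = 0 := fun x hx => fderiv_of_notMem_tsupport _ hx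
  have hXK : ∀ x ∉ K, X x = 0 := fun x hx => image_eq_zero_of_notMem_tsupport hx
  obtain ⟨δ, hδ, C, hC, hdet⟩ := exists_abs_det_one_add_sub_one_le (m := m)
  have hMB0 : 0 ≤ MB := (norm_nonneg _).trans (hMB 0)
  have hsmall : ∀ᶠ t : ℝ in 𝓝 0, |t| * L < 1 ∧ |t| * MB < δ ∧ C * (|t| * MB) < 1 ∧ |t| < 1 := by
    have hc : ∀ c d : ℝ, 0 < d → ∀ᶠ t : ℝ in 𝓝 0, |t| * c < d := fun c d hd => by
      have : Continuous fun t : ℝ => |t| * c := by fun_prop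
      exact this.tendsto 0 |>.eventually_lt_const (by simpa using hd)
    filter_upwards [hc L 1 one_pos, hc MB δ hδ, hc (C * MB) 1 one_pos, hc 1 1 one_pos]
      with t h1 h2 h3 h4
    exact ⟨h1, h2, by linarith [mul_left_comm C |t| MB], by linarith⟩
  set E : ℝ → ℝ := fun t => ∫ x in U, hsNormSq (fderiv ℝ (fun y => f (y + t • X y)) x) with hE
  have hE0 : E 0 = ∫ x in U, hsNormSq (f' x) := by
    simp only [hE, zero_smul, add_zero]
    exact setIntegral_congr_fun hU.measurableSet fun x hx => by
      simp only [(hf x hx).fderiv]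
  have hbij : ∀ t : ℝ, |t| * L < 1 → Function.Bijective fun x => x + t • X x :=
    fun t ht => bijective_add_smul hL ht
  have hmem : ∀ t : ℝ, |t| * L < 1 → ∀ x, (x + t • X x ∈ U ↔ x ∈ U) := fun t ht x =>
    (hbij t ht).mem_iff_of_fix_compl (s := U) (fun y hy => by simp [hXK y fun h => hy (hXU h)]) x
  have hmemK : ∀ t : ℝ, |t| * L < 1 → ∀ x, (x + t • X x ∈ K ↔ x ∈ K) := fun t ht x =>
    (hbij t ht).mem_iff_of_fix_compl (s := K) (fun y hy => by simp [hXK y hy]) x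
  have hdΦ : ∀ (t : ℝ) x, HasFDerivAt (fun y => y + t • X y)
      ((1 : Em m →L[ℝ] Em m) + t • fderiv ℝ X x) x := fun t x =>
    (hasFDerivAt_id x).add ((hXd x).const_smul t)
  have hdetb : ∀ t : ℝ, |t| * MB < δ → ∀ x,
      |((1 : Em m →L[ℝ] Em m) + t • fderiv ℝ X x).det - 1| ≤ C * (|t| * MB) := by
    intro t ht x
    have hn : ‖t • fderiv ℝ X x‖ ≤ |t| * MB := by
      rw [norm_smul, Real.norm_eq_abs]; gcongr; exact hMB x
    exact (hdet _ (hn.trans_lt ht)).trans (by gcongr)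
  have hqc : ∀ t : ℝ, |t| * L < 1 → ContinuousOn
      (fun x => squeezeQuotient (f' (x + t • X x)) (fderiv ℝ X x) t) U := by
    intro t ht
    have hA : ContinuousOn (fun x => f' (x + t • X x)) U :=
      hf'c.comp (by have := hX.continuous; fun_prop) fun x hx => (hmem t ht x).2 hx
    have hAB : ContinuousOn (fun x => (f' (x + t • X x)).comp (fderiv ℝ X x)) U :=
      hA.clm_comp hdX.continuousOn
    have hdetc : Continuous fun x => ((1 : Em m →L[ℝ] Em m) + t • fderiv ℝ X x).det :=
      differentiable_det.continuous.comp (by fun_prop)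
    unfold squeezeQuotient
    exact ((continuousOn_const.mul (hA.hsInner hAB)).add (continuousOn_const.mul hAB.hsNormSq)).sub
      (hA.hsNormSq.mul ((hdetc.continuousOn.sub continuousOn_const).div_const _))
  have hq0 : ∀ (t : ℝ), ∀ x ∈ U \ K,
      squeezeQuotient (f' (x + t • X x)) (fderiv ℝ X x) t = 0 := by
    intro t x hx
    have h1 : (1 : Em m →L[ℝ] Em m).det = 1 := by simp [ContinuousLinearMap.det]
    have h2 : ((1 : Em m →L[ℝ] Em m) + t • (0 : Em m →L[ℝ] Em m)).det = 1 := by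
      rw [← h1]
      congr 1
      ext1 v
      simp
    rw [squeezeQuotient, hdXK x hx.2, h2]
    simp [hsInner, hsNormSq]
  have hslope : ∀ᶠ t : ℝ in 𝓝[≠] 0, slope E 0 t =
      ∫ x in K, squeezeQuotient (f' (x + t • X x)) (fderiv ℝ X x) t := by
    filter_upwards [nhdsWithin_le_nhds hsmall, self_mem_nhdsWithin] with t ht ht0
    obtain ⟨ht1, ht2, ht3, -⟩ := ht
    have ht0 : t ≠ 0 := ht0
    have himg : (fun y => y + t • X y) '' U = U := by
      ext z
      constructor
      · rintro ⟨x, hx, rfl⟩; exact (hmem t ht1 x).2 hx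
      · intro hz
        obtain ⟨x, rfl⟩ := (hbij t ht1).2 z
        exact ⟨x, (hmem t ht1 x).1 hz, rfl⟩
    have hpos : ∀ x, |((1 : Em m →L[ℝ] Em m) + t • fderiv ℝ X x).det| =
        ((1 : Em m →L[ℝ] Em m) + t • fderiv ℝ X x).det := by
      intro x
      have := abs_le.1 (hdetb t ht2 x)
      exact abs_of_pos (by linarith)
    have hcov : ∫ x in U, hsNormSq (f' x) = ∫ x in U,
        ((1 : Em m →L[ℝ] Em m) + t • fderiv ℝ X x).det * hsNormSq (f' (x + t • X x)) := by
      have := integral_image_eq_integral_abs_det_fderiv_smul volume hU.measurableSet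
        (fun x _ => (hdΦ t x).hasFDerivWithinAt) ((hbij t ht1).1.injOn)
        (fun x => hsNormSq (f' x))
      rw [himg] at this
      simpa only [hpos, smul_eq_mul] using this
    have hcovi : IntegrableOn (fun x =>
        ((1 : Em m →L[ℝ] Em m) + t • fderiv ℝ X x).det * hsNormSq (f' (x + t • X x))) U := by
      have := (integrableOn_image_iff_integrableOn_abs_det_fderiv_smul volume hU.measurableSet
        (fun x _ => (hdΦ t x).hasFDerivWithinAt) ((hbij t ht1).1.injOn)
        (fun x => hsNormSq (f' x))).1 (by rw [himg]; exact hfin)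
      simpa only [hpos, smul_eq_mul] using this
    have hqi := integrableOn_of_continuousOn_of_eq_zero hU hK hXU (hqc t ht1) (hq0 t)
    have hEt : E t = (∫ x in U, hsNormSq (f' x)) +
        t * ∫ x in U, squeezeQuotient (f' (x + t • X x)) (fderiv ℝ X x) t := by
      rw [hcov, ← integral_const_mul, ← integral_add hcovi (hqi.const_mul t)]
      refine setIntegral_congr_fun hU.measurableSet fun x hx => ?_
      have hd : HasFDerivAt (fun y => f (y + t • X y)) _ x :=
        (hf _ ((hmem t ht1 x).2 hx)).comp x (hdΦ t x)
      simp only [hd.fderiv]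
      exact squeezeQuotient_spec _ _ ht0
    rw [slope_def_field, hEt, hE0, setIntegral_eq_of_subset_of_forall_sdiff_eq_zero
      hU.measurableSet hXU (hq0 t)]
    rw [add_sub_cancel_left, sub_zero, mul_div_cancel_left₀ _ ht0]
  have hlim : Filter.Tendsto
      (fun t : ℝ => ∫ x in K, squeezeQuotient (f' (x + t • X x)) (fderiv ℝ X x) t) (𝓝[≠] 0)
      (𝓝 (∫ x in K, (2 * hsInner (f' x) ((f' x).comp (fderiv ℝ X x)) -
        hsNormSq (f' x) * divg X x))) := by
    refine tendsto_integral_filter_of_dominated_convergence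
      (fun _ => 2 * (m * (MA * (MA * MB))) + m * (MA * MB) ^ 2 + m * MA ^ 2 * (C * MB)) ?_ ?_ ?_ ?_
    · filter_upwards [nhdsWithin_le_nhds hsmall] with t ht
      exact ((hqc t ht.1).mono hXU).aestronglyMeasurable hKm
    · filter_upwards [nhdsWithin_le_nhds hsmall, self_mem_nhdsWithin] with t ht ht0
      refine (ae_restrict_iff' hKm).2 (Filter.Eventually.of_forall fun x hx => ?_)
      obtain ⟨ht1, ht2, ht3, ht4⟩ := ht
      have ht0 : 0 < |t| := abs_pos.2 ht0
      obtain ⟨b1, b2, b3⟩ := norm_comp_sq_bound (hMA _ ((hmemK t ht1 x).2 hx)) (hMB x)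
      have hd := hdetb t ht2 x
      rw [squeezeQuotient, Real.norm_eq_abs]
      refine (abs_sub _ _).trans (add_le_add ((abs_add_le _ _).trans (add_le_add ?_ ?_)) ?_)
      · rw [abs_mul, abs_two]; gcongr
      · rw [abs_mul, abs_of_nonneg (hsNormSq_nonneg _)]
        calc _ ≤ 1 * hsNormSq ((f' (x + t • X x)).comp (fderiv ℝ X x)) := by
              gcongr; exact hsNormSq_nonneg _
          _ ≤ _ := by rw [one_mul]; exact b2
      · rw [abs_mul, abs_of_nonneg (hsNormSq_nonneg _), abs_div]
        have : |((1 : Em m →L[ℝ] Em m) + t • fderiv ℝ X x).det - 1| / |t| ≤ C * MB := by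
          rw [div_le_iff₀ ht0]; linarith [mul_left_comm C |t| MB]
        gcongr
    · exact continuousOn_const.integrableOn_compact hK
    · refine (ae_restrict_iff' hKm).2 (Filter.Eventually.of_forall fun x hx => ?_)
      have hA : Filter.Tendsto (fun t : ℝ => f' (x + t • X x)) (𝓝[≠] 0) (𝓝 (f' x)) := by
        have h1 : ContinuousAt f' x := hf'c.continuousAt (hU.mem_nhds (hXU hx))
        have h2 : Filter.Tendsto (fun t : ℝ => x + t • X x) (𝓝[≠] 0) (𝓝 x) := by
          have : Continuous fun t : ℝ => x + t • X x := by fun_prop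
          have := this.tendsto 0
          simp only [zero_smul, add_zero] at this
          exact this.mono_left nhdsWithin_le_nhds
        exact h1.tendsto.comp h2
      have hdt := (hasDerivAt_iff_tendsto_slope.1 (hasDerivAt_det_one_add_smul (fderiv ℝ X x)))
      have hdt' : Filter.Tendsto
          (fun t : ℝ => (((1 : Em m →L[ℝ] Em m) + t • fderiv ℝ X x).det - 1) / t)
          (𝓝[≠] 0) (𝓝 (divg X x)) := by
        refine hdt.congr fun t => ?_
        rw [slope_def_field]
        simp [ContinuousLinearMap.det]
      have hAB : Filter.Tendsto (fun t : ℝ => (f' (x + t • X x)).comp (fderiv ℝ X x)) (𝓝[≠] 0)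
          (𝓝 ((f' x).comp (fderiv ℝ X x))) := 
        ((continuous_id.clm_comp continuous_const).tendsto (f' x)).comp hA
      have hin : Filter.Tendsto (fun t : ℝ => hsInner (f' (x + t • X x))
          ((f' (x + t • X x)).comp (fderiv ℝ X x))) (𝓝[≠] 0)
          (𝓝 (hsInner (f' x) ((f' x).comp (fderiv ℝ X x)))) := by
        unfold hsInner
        refine tendsto_finsetSum _ fun i _ => ?_
        have hev : ∀ v : Em m, Continuous fun A : Em m →L[ℝ] ell2 => A v := fun v =>
          continuous_id.clm_apply continuous_const
        exact (((hev _).tendsto _).comp hA).inner (((hev _).tendsto _).comp hAB)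
      have ht : Filter.Tendsto (fun t : ℝ => t) (𝓝[≠] 0) (𝓝 0) := nhdsWithin_le_nhds
      have := ((hin.const_mul 2).add
        (ht.mul ((continuous_hsNormSq.tendsto _).comp hAB))).sub
        (((continuous_hsNormSq.tendsto _).comp hA).mul hdt')
      simpa [squeezeQuotient] using this
  have hzero := tendsto_nhds_unique ((hasDerivAt_iff_tendsto_slope.1 h).congr' hslope) hlim
  rw [setIntegral_eq_of_subset_of_forall_sdiff_eq_zero hU.measurableSet hXU]
  · exact hzero.symm
  · intro x hx
    simp [divg, hdXK x hx.2, hsInner]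

theorem sum_coord_smul_apply {m : ℕ} (A : Em m →L[ℝ] ell2) (v : Em m) :
    ∑ i : Fin m, v i • A (EuclideanSpace.single i 1) = A v := by
  conv_rhs => rw [← (EuclideanSpace.basisFun (Fin m) ℝ).sum_repr v]
  simp [map_sum]

theorem hsInner_smul_add_smulRight {m : ℕ} (A : Em m →L[ℝ] ell2) (η c : ℝ) (v : Em m) (y : ell2) :
    hsInner A (η • A + (c • innerSL ℝ v).smulRight y) = η * hsNormSq A + c * ⟪A v, y⟫ := by
  rw [← sum_coord_smul_apply A v, sum_inner, hsInner, hsNormSq, Finset.mul_sum, Finset.mul_sum,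
    ← Finset.sum_add_distrib]
  refine Finset.sum_congr rfl fun i _ => ?_
  simp only [add_apply, smul_apply,
    ContinuousLinearMap.smulRight_apply, innerSL_apply_apply, inner_add_right, inner_smul_right,
    real_inner_self_eq_norm_sq, inner_smul_left, EuclideanSpace.inner_single_right, smul_eq_mul]
  simp
  ring

/-- Data of a smooth radial cut-off profile: `φ` is smooth with derivative `-ψ`, is constant below
`ε > 0` and vanishes above `b`. -/
structure RadialProfile (φ ψ : ℝ → ℝ) (ε b : ℝ) : Prop where
  contDiff : ContDiff ℝ (⊤ : ℕ∞) φ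
  hasDerivAt : ∀ s, HasDerivAt φ (-ψ s) s
  pos : 0 < ε
  const_below : ∀ s < ε, φ s = φ 0
  eq_zero_below : ∀ s < ε, ψ s = 0
  eq_zero_above : ∀ s, b ≤ s → φ s = 0

namespace RadialProfile

variable {m : ℕ} {φ ψ : ℝ → ℝ} {ε b : ℝ}

theorem eventuallyEq_center (h : RadialProfile φ ψ ε b) (a : Em m) :
    (fun x : Em m => φ ‖x - a‖) =ᶠ[𝓝 a] fun _ => φ 0 := by
  filter_upwards [ball_mem_nhds a h.pos] with x hx
  exact h.const_below _ (by rwa [mem_ball, dist_eq_norm] at hx)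

theorem contDiff_radial (h : RadialProfile φ ψ ε b) (a : Em m) :
    ContDiff ℝ (⊤ : ℕ∞) fun x : Em m => φ ‖x - a‖ := by
  refine contDiff_iff_contDiffAt.2 fun x => ?_
  rcases eq_or_ne x a with rfl | hx
  · exact contDiffAt_const.congr_of_eventuallyEq (h.eventuallyEq_center x)
  · exact h.contDiff.contDiffAt.comp x
      ((contDiffAt_id.sub contDiffAt_const).norm ℝ (sub_ne_zero.2 hx))

theorem hasFDerivAt_radial (h : RadialProfile φ ψ ε b) (a x : Em m) :
    HasFDerivAt (fun x : Em m => φ ‖x - a‖)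
      ((-(ψ ‖x - a‖ / ‖x - a‖)) • innerSL ℝ (x - a)) x := by
  rcases eq_or_ne x a with rfl | hx
  · simp only [sub_self, norm_zero, div_zero, neg_zero, zero_smul]
    exact (hasFDerivAt_const (φ 0) x).congr_of_eventuallyEq (h.eventuallyEq_center x)
  · have hn : ‖x - a‖ ≠ 0 := norm_ne_zero_iff.2 (sub_ne_zero.2 hx)
    have h1 : HasFDerivAt (fun y : Em m => ‖y - a‖ ^ 2) (2 • innerSL ℝ (x - a)) x :=
      ((hasFDerivAt_id x).sub_const a).norm_sq
    have h2 : HasFDerivAt (fun y : Em m => ‖y - a‖) (‖x - a‖⁻¹ • innerSL ℝ (x - a)) x := by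
      have := h1.sqrt (by positivity)
      simp only [Real.sqrt_sq (norm_nonneg _)] at this
      refine this.congr_fderiv (ContinuousLinearMap.ext fun v => ?_)
      simp
      field_simp
    refine ((h.hasDerivAt ‖x - a‖).comp_hasFDerivAt x h2).congr_fderiv
      (ContinuousLinearMap.ext fun v => ?_)
    simp
    ring

theorem tsupport_radial_subset (h : RadialProfile φ ψ ε b) (a : Em m) :
    tsupport (fun x : Em m => φ ‖x - a‖) ⊆ closedBall a b := by
  refine closure_minimal (fun x hx => ?_) isClosed_closedBall
  rw [mem_closedBall, dist_eq_norm]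
  by_contra hlt
  exact hx (h.eq_zero_above _ (not_le.1 hlt).le)

theorem hasCompactSupport_radial (h : RadialProfile φ ψ ε b) (a : Em m) :
    HasCompactSupport fun x : Em m => φ ‖x - a‖ :=
  (isCompact_closedBall a b).of_isClosed_subset (isClosed_tsupport _) (h.tsupport_radial_subset a)

/-- The outer variation tested with a radial cut-off of `f`. -/
theorem outer_identity (h : RadialProfile φ ψ ε b) {U : Set (Em m)} (hU : IsOpen U)
    {f : Em m → ell2} {f' : Em m → (Em m →L[ℝ] ell2)}
    (hf : ∀ x ∈ U, HasFDerivAt f (f' x) x) (hf'c : ContinuousOn f' U)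
    (hfin : IntegrableOn (fun x => hsNormSq (f' x)) U volume)
    (hsquash : SquashStationary U f) {a : Em m} (hb : closedBall a b ⊆ U) :
    ∫ x in U, (φ ‖x - a‖ * hsNormSq (f' x) -
      ψ ‖x - a‖ / ‖x - a‖ * ⟪f' x (x - a), f x⟫) = 0 := by
  have hsupp : tsupport (fun x : Em m => φ ‖x - a‖ • f x) ⊆ tsupport fun x : Em m => φ ‖x - a‖ :=
    tsupport_smul_subset_left _ _
  have htU := (hsupp.trans (h.tsupport_radial_subset a)).trans hb
  have hu : ContDiff ℝ 1 fun x : Em m => φ ‖x - a‖ • f x := by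
    refine contDiff_iff_contDiffAt.2 fun x => ?_
    by_cases hx : x ∈ U
    · exact ((h.contDiff_radial a).contDiffAt.of_le (by exact_mod_cast le_top)).smul
        ((contDiffOn_one_of_hasFDerivAt hU hf hf'c).contDiffAt (hU.mem_nhds hx))
    · have : (fun x : Em m => φ ‖x - a‖ • f x) =ᶠ[𝓝 x] 0 :=
        notMem_tsupport_iff_eventuallyEq.1 fun hx' => hx (htU hx')
      exact contDiffAt_const.congr_of_eventuallyEq this
  rw [← hsquash.integral_hsInner_eq_zero hU hf hf'c hfin hu
    ((h.hasCompactSupport_radial a).smul_right) htU]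
  refine setIntegral_congr_fun hU.measurableSet fun x hx => ?_
  have hd := (h.hasFDerivAt_radial a x).smul (hf x hx)
  have hd' : fderiv ℝ (fun x : Em m => φ ‖x - a‖ • f x) x = _ := hd.fderiv
  simp only [hd', hsInner_smul_add_smulRight]
  ring

/-- The inner variation tested with a radial field. -/
theorem inner_identity (h : RadialProfile φ ψ ε b) {U : Set (Em m)} (hU : IsOpen U)
    {f : Em m → ell2} {f' : Em m → (Em m →L[ℝ] ell2)}
    (hf : ∀ x ∈ U, HasFDerivAt f (f' x) x) (hf'c : ContinuousOn f' U)
    (hfin : IntegrableOn (fun x => hsNormSq (f' x)) U volume)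
    (hsqueeze : SqueezeStationary U f) {a : Em m} (hb : closedBall a b ⊆ U) :
    ∫ x in U, ((2 - m) * (φ ‖x - a‖ * hsNormSq (f' x)) +
      ψ ‖x - a‖ / ‖x - a‖ * (‖x - a‖ ^ 2 * hsNormSq (f' x) - 2 * ‖f' x (x - a)‖ ^ 2)) = 0 := by
  have hsupp : tsupport (fun x : Em m => φ ‖x - a‖ • (x - a)) ⊆
      tsupport fun x : Em m => φ ‖x - a‖ := tsupport_smul_subset_left _ _
  have hX : ContDiff ℝ (⊤ : ℕ∞) fun x : Em m => φ ‖x - a‖ • (x - a) :=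
    (h.contDiff_radial a).smul (contDiff_id.sub contDiff_const)
  rw [← hsqueeze.integral_eq_zero hU hf hf'c hfin hX ((h.hasCompactSupport_radial a).smul_right)
    ((hsupp.trans (h.tsupport_radial_subset a)).trans hb)]
  refine setIntegral_congr_fun hU.measurableSet fun x hx => ?_
  have hd := (h.hasFDerivAt_radial a x).smul ((hasFDerivAt_id x).sub_const a)
  have hd' : fderiv ℝ (fun x : Em m => φ ‖x - a‖ • (x - a)) x = _ := hd.fderiv
  have hcomp : (f' x).comp (fderiv ℝ (fun x : Em m => φ ‖x - a‖ • (x - a)) x) =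
      φ ‖x - a‖ • f' x + ((-(ψ ‖x - a‖ / ‖x - a‖)) • innerSL ℝ (x - a)).smulRight
        (f' x (x - a)) := by
    rw [hd']
    ext1 v
    simp
  have hdiv : divg (fun x : Em m => φ ‖x - a‖ • (x - a)) x =
      m * φ ‖x - a‖ - ψ ‖x - a‖ / ‖x - a‖ * ‖x - a‖ ^ 2 := by
    rw [divg, hd', EuclideanSpace.real_norm_sq_eq, Finset.mul_sum]
    have : (m : ℝ) * φ ‖x - a‖ = ∑ _i : Fin m, φ ‖x - a‖ := by simp
    rw [this, ← Finset.sum_sub_distrib]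
    refine Finset.sum_congr rfl fun i _ => ?_
    simp [EuclideanSpace.inner_single_right, inner_add_left]
    ring
  simp only [hcomp, hsInner_smul_add_smulRight, hdiv, real_inner_self_eq_norm_sq]
  ring

end RadialProfile

/-- Every smooth `ψ` supported in a compact subinterval of `(0, d)` has a radial primitive. -/
theorem exists_radialProfile {d : ℝ} {ψ : ℝ → ℝ} (hd : 0 < d) (hψ : ContDiff ℝ (⊤ : ℕ∞) ψ)
    (hψc : HasCompactSupport ψ) (hψd : tsupport ψ ⊆ Set.Ioo 0 d) :
    ∃ φ ε b, RadialProfile φ ψ ε b ∧ 0 < b ∧ b < d ∧ ∀ s, b ≤ s → ψ s = 0 := by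
  obtain ⟨ε, b, hε, hb0, hb, hsub⟩ : ∃ ε b : ℝ, 0 < ε ∧ 0 < b ∧ b < d ∧
      tsupport ψ ⊆ Set.Ioo ε b := by
    rcases (tsupport ψ).eq_empty_or_nonempty with he | hne
    · exact ⟨d / 2, d / 2, by linarith, by linarith, by linarith, by simp [he]⟩
    · have h1 := hψd (hψc.isCompact.sInf_mem hne)
      have h2 := hψd (hψc.isCompact.sSup_mem hne)
      refine ⟨sInf (tsupport ψ) / 2, (sSup (tsupport ψ) + d) / 2, by linarith [h1.1],
        by linarith [h2.1], by linarith [h2.2], fun s hs => ⟨?_, ?_⟩⟩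
      · linarith [h1.1, csInf_le hψc.isCompact.bddBelow hs]
      · linarith [h2.2, le_csSup hψc.isCompact.bddAbove hs]
  have hψ0 : ∀ s, s ∉ Set.Ioo ε b → ψ s = 0 := fun s hs =>
    image_eq_zero_of_notMem_tsupport fun h => hs (hsub h)
  have hder : ∀ s, HasDerivAt (fun s => ∫ t in s..b, ψ t) (-ψ s) s := fun s =>
    intervalIntegral.integral_hasDerivAt_left (hψ.continuous.intervalIntegrable _ _)
      (hψ.continuous.stronglyMeasurableAtFilter _ _) hψ.continuous.continuousAt
  refine ⟨fun s => ∫ t in s..b, ψ t, ε, b, ⟨?_, hder, hε, ?_, ?_, ?_⟩, hb0, hb, ?_⟩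
  · refine contDiff_infty_iff_deriv.2 ⟨fun s => (hder s).differentiableAt, ?_⟩
    rw [show deriv (fun s => ∫ t in s..b, ψ t) = fun s => -ψ s from funext fun s => (hder s).deriv]
    exact hψ.neg
  · intro s hs
    have h0 : ∫ t in s..0, ψ t = 0 := by
      rw [intervalIntegral.integral_congr (g := fun _ => (0 : ℝ)), intervalIntegral.integral_zero]
      intro t ht
      have : t ≤ max s 0 := ht.2
      exact hψ0 t fun h => absurd (h.1.trans_le this) (not_lt.2 (max_le hs.le hε.le))
    rw [← intervalIntegral.integral_add_adjacent_intervals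
      (hψ.continuous.intervalIntegrable s 0) (hψ.continuous.intervalIntegrable 0 b), h0, zero_add]
  · exact fun s hs => hψ0 s fun h => absurd h.1 (not_lt.2 hs.le)
  · intro s hs
    rw [intervalIntegral.integral_congr (g := fun _ => (0 : ℝ)), intervalIntegral.integral_zero]
    intro t ht
    have : min s b ≤ t := ht.1
    rw [min_eq_right hs] at this
    exact hψ0 t fun h => absurd h.2 (not_lt.2 this)
  · exact fun s hs => hψ0 s fun h => absurd h.2 (not_lt.2 hs)

/-- The integral of `g` over the sphere of radius `s` around `a`, in polar coordinates. -/
def shellIntegral {m : ℕ} (a : Em m) (g : Em m → ℝ) (s : ℝ) : ℝ :=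
  s ^ (m - 1) * ∫ ω : sphere (0 : Em m) 1, g (a + s • (ω : Em m))
    ∂(volume : Measure (Em m)).toSphere

theorem add_smul_sphere_mem_ball {m : ℕ} (a : Em m) (ω : sphere (0 : Em m) 1) {s d : ℝ}
    (hs : s ∈ Set.Ioo (-d) d) : a + s • (ω : Em m) ∈ ball a d := by
  have : |s| < d := abs_lt.2 hs
  simpa [norm_smul] using this

theorem continuousOn_shellIntegral {m : ℕ} {a : Em m} {g : Em m → ℝ} {d : ℝ}
    (hg : ContinuousOn g (ball a d)) : ContinuousOn (shellIntegral a g) (Set.Ioo (-d) d) := by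
  refine (continuousOn_id.pow _).mul ?_
  refine continuousOn_integral_of_compact_support (k := Set.univ) isCompact_univ ?_
    fun _ _ _ h => absurd (Set.mem_univ _) h
  refine hg.comp (by fun_prop) fun p hp => add_smul_sphere_mem_ball a p.2 hp.1

theorem setIntegral_closedBall_radial_mul {m : ℕ} (hm : 2 ≤ m) {a : Em m} {g w : _ → ℝ} {b : ℝ}
    (hb : 0 ≤ b) (hw : Continuous w) (hg : ContinuousOn g (closedBall a b)) :
    ∫ x in closedBall a b, w ‖x - a‖ * g x = ∫ s in (0 : ℝ)..b, w s * shellIntegral a g s := by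
  have hcont : ContinuousOn (fun x => w ‖x - a‖ * g x) (closedBall a b) :=
    (hw.comp (by fun_prop : Continuous fun x : Em m => ‖x - a‖)).continuousOn.mul hg
  rw [← integral_indicator isClosed_closedBall.measurableSet, integral_eq_integral_polar hm a
    ((hcont.integrableOn_compact (isCompact_closedBall a b)).integrable_indicator
      isClosed_closedBall.measurableSet), intervalIntegral.integral_of_le hb,
    ← Set.Ioi_inter_Iic, ← setIntegral_indicator measurableSet_Iic]
  refine setIntegral_congr_fun measurableSet_Ioi fun s hs => ?_
  have hs : 0 < s := hs
  have hn : ∀ ω : sphere (0 : Em m) 1, ‖s • (ω : Em m)‖ = s := fun ω => by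
    simp [norm_smul, abs_of_pos hs]
  by_cases hsb : s ≤ b
  · have hmem : ∀ ω : sphere (0 : Em m) 1, a + s • (ω : Em m) ∈ closedBall a b := fun ω => by
      rw [mem_closedBall, dist_eq_norm, add_sub_cancel_left, hn]; exact hsb
    simp only [Set.indicator_of_mem (hmem _), Set.indicator_of_mem (Set.mem_Iic.2 hsb),
      add_sub_cancel_left, hn, integral_const_mul, shellIntegral]
    ring
  · have hmem : ∀ ω : sphere (0 : Em m) 1, a + s • (ω : Em m) ∉ closedBall a b := fun ω => by
      rw [mem_closedBall, dist_eq_norm, add_sub_cancel_left, hn]; exact hsb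
    simp [Set.indicator_of_notMem (hmem _), Set.indicator_of_notMem (Set.mem_Iic.not.2 hsb)]

theorem setIntegral_ball_eq {m : ℕ} (hm : 2 ≤ m) {a : Em m} {g : Em m → ℝ} {d b : ℝ}
    (hb : 0 ≤ b) (hbd : b < d) (hg : ContinuousOn g (ball a d)) :
    ∫ x in ball a b, g x = ∫ s in (0 : ℝ)..b, shellIntegral a g s := by
  have : Nontrivial (Em m) := by
    have : Nonempty (Fin m) := ⟨⟨0, by omega⟩⟩
    infer_instance
  have hae : (ball a b : Set (Em m)) =ᵐ[volume] closedBall a b := by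
    rw [← ball_union_sphere]
    exact (union_ae_eq_left_of_ae_eq_empty
      (ae_eq_empty.2 (Measure.addHaar_sphere volume a b))).symm
  have := setIntegral_closedBall_radial_mul hm (w := fun _ => 1) hb continuous_const
    (hg.mono (closedBall_subset_ball hbd))
  rw [setIntegral_congr_set hae]
  simpa using this

theorem hasDerivAt_integral_shellIntegral {m : ℕ} {a : Em m} {g : Em m → ℝ} {d s : ℝ}
    (hg : ContinuousOn g (ball a d)) (hs : s ∈ Set.Ioo (-d) d) :
    HasDerivAt (fun ρ => ∫ t in (0 : ℝ)..ρ, shellIntegral a g t) (shellIntegral a g s) s := by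
  have hc := continuousOn_shellIntegral hg
  have h0 : (0 : ℝ) ∈ Set.Ioo (-d) d := ⟨by linarith [hs.1, hs.2], by linarith [hs.1, hs.2]⟩
  refine intervalIntegral.integral_hasDerivAt_right
    (hc.mono (Set.ordConnected_Ioo.uIcc_subset h0 hs)).intervalIntegrable
    (hc.stronglyMeasurableAtFilter isOpen_Ioo s hs) (hc.continuousAt (isOpen_Ioo.mem_nhds hs))

/-- The fundamental lemma of the calculus of variations for radial profiles. -/
theorem eq_zero_of_forall_radialProfile {d : ℝ} (hd : 0 < d) {h : ℝ → ℝ}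
    (hc : ContinuousOn h (Set.Ioo 0 d))
    (hint : ∀ φ ψ ε b, RadialProfile φ ψ ε b → ContDiff ℝ (⊤ : ℕ∞) ψ → 0 < b → b < d →
      (∀ s, b ≤ s → ψ s = 0) → ∫ s in (0 : ℝ)..b, ψ s * h s = 0) :
    ∀ s ∈ Set.Ioo 0 d, h s = 0 := by
  have hae : ∀ᵐ s : ℝ, s ∈ Set.Ioo 0 d → h s = 0 := by
    refine isOpen_Ioo.ae_eq_zero_of_integral_contDiff_smul_eq_zero
      (hc.locallyIntegrableOn isOpen_Ioo.measurableSet) fun ψ hψ hψc hψd => ?_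
    obtain ⟨φ, ε, b, hφ, hb, hbd, hψb⟩ := exists_radialProfile hd hψ hψc hψd
    rw [← hint φ ψ ε b hφ hψ hb hbd hψb, intervalIntegral.integral_of_le hb.le]
    refine (setIntegral_eq_integral_of_forall_compl_eq_zero fun s hs => ?_).symm
    have : ψ s = 0 := by
      rcases le_or_gt s 0 with h0 | h0
      · exact hφ.eq_zero_below s (h0.trans_lt hφ.pos)
      · exact hψb s (le_of_lt (not_le.1 fun h => hs ⟨h0, h⟩))
    simp [this]
  exact Measure.eqOn_open_of_ae_eq (μ := volume) (g := fun _ => 0)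
    ((ae_restrict_iff' measurableSet_Ioo).2 hae) isOpen_Ioo hc continuousOn_const

namespace RadialProfile

variable {φ ψ : ℝ → ℝ} {ε b : ℝ}

theorem continuous_div (h : RadialProfile φ ψ ε b) (hψ : Continuous ψ) :
    Continuous fun s => ψ s / s := by
  refine continuous_iff_continuousAt.2 fun s => ?_
  rcases eq_or_ne s 0 with rfl | hs
  · refine (continuousAt_const (y := (0 : ℝ))).congr ?_
    filter_upwards [Iio_mem_nhds h.pos] with t ht
    simp [h.eq_zero_below t ht]
  · exact hψ.continuousAt.div continuousAt_id hs

theorem integral_mul_eq {m : ℕ} (h : RadialProfile φ ψ ε b) (hψ : Continuous ψ) {a : Em m}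
    {g : Em m → ℝ} {d : ℝ} (hb : 0 ≤ b) (hbd : b < d) (hg : ContinuousOn g (ball a d)) :
    ∫ s in (0 : ℝ)..b, φ s * shellIntegral a g s =
      ∫ s in (0 : ℝ)..b, ψ s * ∫ t in (0 : ℝ)..s, shellIntegral a g t := by
  have hsub : Set.uIcc 0 b ⊆ Set.Ioo (-d) d := by
    rw [Set.uIcc_of_le hb]
    exact fun s hs => ⟨by linarith [hs.1], by linarith [hs.2]⟩
  rw [intervalIntegral.integral_mul_deriv_eq_deriv_mul (fun s _ => h.hasDerivAt s)
    (fun s hs => hasDerivAt_integral_shellIntegral hg (hsub hs))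
    (hψ.neg.intervalIntegrable _ _)
    ((continuousOn_shellIntegral hg).mono hsub).intervalIntegrable]
  simp [h.eq_zero_above b le_rfl]

end RadialProfile

namespace RadialProfile

variable {m : ℕ} {φ ψ : ℝ → ℝ} {ε b d : ℝ} {U : Set (Em m)} {a : Em m} {g₁ g₂ : Em m → ℝ}

/-- A radially weighted integral over `U`, in polar coordinates and after integration by parts. -/
theorem setIntegral_eq (h : RadialProfile φ ψ ε b) (hm : 2 ≤ m) (hψ : Continuous ψ)
    (hb : 0 < b) (hbd : b < d) (hψb : ∀ s, b ≤ s → ψ s = 0) (hU : IsOpen U) (hdU : ball a d ⊆ U)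
    (hg₁ : ContinuousOn g₁ (ball a d)) (hg₂ : ContinuousOn g₂ (ball a d)) :
    ∫ x in U, (φ ‖x - a‖ * g₁ x + ψ ‖x - a‖ / ‖x - a‖ * g₂ x) =
      ∫ s in (0 : ℝ)..b, ψ s * ((∫ t in (0 : ℝ)..s, shellIntegral a g₁ t) +
        shellIntegral a g₂ s / s) := by
  have hsub : closedBall a b ⊆ ball a d := closedBall_subset_ball hbd
  have hn : Continuous fun x : Em m => ‖x - a‖ := by fun_prop
  have hκ := h.continuous_div hψ
  have hI : Set.uIcc 0 b ⊆ Set.Ioo (-d) d := by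
    rw [Set.uIcc_of_le hb.le]
    exact fun s hs => ⟨by linarith [hs.1], by linarith [hs.2]⟩
  rw [setIntegral_eq_of_subset_of_forall_sdiff_eq_zero hU.measurableSet (hsub.trans hdU),
    integral_add, setIntegral_closedBall_radial_mul hm hb.le h.contDiff.continuous (hg₁.mono hsub),
    setIntegral_closedBall_radial_mul hm (w := fun s => ψ s / s) hb.le hκ (hg₂.mono hsub),
    h.integral_mul_eq hψ hb.le hbd hg₁, ← intervalIntegral.integral_add]
  · exact intervalIntegral.integral_congr fun s _ => by ring
  · refine (hψ.continuousOn.mul fun s hs => ?_).intervalIntegrable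
    exact (hasDerivAt_integral_shellIntegral hg₁ (hI hs)).continuousAt.continuousWithinAt
  · exact (hκ.continuousOn.mul ((continuousOn_shellIntegral hg₂).mono hI)).intervalIntegrable
  · exact ((h.contDiff.continuous.comp hn).continuousOn.mul
      (hg₁.mono hsub)).integrableOn_compact (isCompact_closedBall a b)
  · exact ((hκ.comp hn).continuousOn.mul
      (hg₂.mono hsub)).integrableOn_compact (isCompact_closedBall a b)
  · intro x hx
    have : b ≤ ‖x - a‖ := by
      have := hx.2
      rw [mem_closedBall, dist_eq_norm] at this
      exact (not_le.1 this).le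
    simp [h.eq_zero_above _ this, hψb _ this]

end RadialProfile

section Stationary

variable {m : ℕ} {U : Set (Em m)} {f : Em m → ell2} {f' : Em m → (Em m →L[ℝ] ell2)}
  {a : Em m} {d : ℝ}

theorem continuousOn_radial_apply (hf'c : ContinuousOn f' U) (a : Em m) :
    ContinuousOn (fun x => f' x (x - a)) U :=
  hf'c.clm_apply (by fun_prop)

/-- Outer variations: the energy of a ball is a boundary integral. -/
theorem SquashStationary.mul_energy_eq (hm : 2 ≤ m) (hU : IsOpen U)
    (hf : ∀ x ∈ U, HasFDerivAt f (f' x) x) (hf'c : ContinuousOn f' U)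
    (hfin : IntegrableOn (fun x => hsNormSq (f' x)) U volume) (hsquash : SquashStationary U f)
    (hdU : ball a d ⊆ U) {s : ℝ} (hs : s ∈ Set.Ioo 0 d) :
    s * ∫ t in (0 : ℝ)..s, shellIntegral a (fun x => hsNormSq (f' x)) t =
      shellIntegral a (fun x => ⟪f' x (x - a), f x⟫) s := by
  have hfc : ContinuousOn f U := fun x hx => (hf x hx).continuousAt.continuousWithinAt
  have hg₁ : ContinuousOn (fun x => hsNormSq (f' x)) (ball a d) := hf'c.hsNormSq.mono hdU
  have hg₂ : ContinuousOn (fun x => -⟪f' x (x - a), f x⟫) (ball a d) :=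
    (((continuousOn_radial_apply hf'c a).inner hfc).mono hdU).neg
  have hIoo : Set.Ioo 0 d ⊆ Set.Ioo (-d) d := fun s hs => ⟨by linarith [hs.1, hs.2], hs.2⟩
  have key := eq_zero_of_forall_radialProfile (hs.1.trans hs.2)
    (h := fun s => (∫ t in (0 : ℝ)..s, shellIntegral a (fun x => hsNormSq (f' x)) t) +
      shellIntegral a (fun x => -⟪f' x (x - a), f x⟫) s / s)
    (ContinuousOn.add (fun s hs =>
      (hasDerivAt_integral_shellIntegral hg₁ (hIoo hs)).continuousAt.continuousWithinAt)
      (((continuousOn_shellIntegral hg₂).mono hIoo).div continuousOn_id fun s hs => hs.1.ne'))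
    (fun φ ψ ε b h hψ hb hbd hψb => by
      rw [← h.setIntegral_eq hm hψ.continuous hb hbd hψb hU hdU hg₁ hg₂,
        ← h.outer_identity hU hf hf'c hfin hsquash ((closedBall_subset_ball hbd).trans hdU)]
      exact integral_congr_ae (Filter.Eventually.of_forall fun x => by ring)) s hs
  have hneg : shellIntegral a (fun x => -⟪f' x (x - a), f x⟫) s =
      -shellIntegral a (fun x => ⟪f' x (x - a), f x⟫) s := by
    simp [shellIntegral, integral_neg]
  rw [hneg] at key
  have hs0 : s ≠ 0 := hs.1.ne'
  field_simp at key
  linarith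

/-- Inner variations: the Pohozaev-type identity on spheres. -/
theorem SqueezeStationary.sq_mul_shellIntegral_eq (hm : 2 ≤ m) (hU : IsOpen U)
    (hf : ∀ x ∈ U, HasFDerivAt f (f' x) x) (hf'c : ContinuousOn f' U)
    (hfin : IntegrableOn (fun x => hsNormSq (f' x)) U volume) (hsqueeze : SqueezeStationary U f)
    (hdU : ball a d ⊆ U) {s : ℝ} (hs : s ∈ Set.Ioo 0 d) :
    s ^ 2 * shellIntegral a (fun x => hsNormSq (f' x)) s =
      (m - 2) * (s * ∫ t in (0 : ℝ)..s, shellIntegral a (fun x => hsNormSq (f' x)) t) +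
        2 * shellIntegral a (fun x => ‖f' x (x - a)‖ ^ 2) s := by
  have hg₀ : ContinuousOn (fun x => hsNormSq (f' x)) (ball a d) := hf'c.hsNormSq.mono hdU
  have hg₁ : ContinuousOn (fun x => (2 - m : ℝ) * hsNormSq (f' x)) (ball a d) :=
    continuousOn_const.mul hg₀
  have hg₃ : ContinuousOn (fun x => ‖f' x (x - a)‖ ^ 2) (ball a d) :=
    ((continuousOn_radial_apply hf'c a).mono hdU).norm.pow 2
  have hn : ContinuousOn (fun x : Em m => ‖x - a‖ ^ 2) (ball a d) := by fun_prop
  have hg₂ : ContinuousOn (fun x => ‖x - a‖ ^ 2 * hsNormSq (f' x) - 2 * ‖f' x (x - a)‖ ^ 2)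
      (ball a d) := (hn.mul hg₀).sub (continuousOn_const.mul hg₃)
  have hIoo : Set.Ioo 0 d ⊆ Set.Ioo (-d) d := fun s hs => ⟨by linarith [hs.1, hs.2], hs.2⟩
  have key := eq_zero_of_forall_radialProfile (hs.1.trans hs.2)
    (h := fun s => (∫ t in (0 : ℝ)..s, shellIntegral a (fun x => (2 - m : ℝ) * hsNormSq (f' x)) t) +
      shellIntegral a (fun x => ‖x - a‖ ^ 2 * hsNormSq (f' x) - 2 * ‖f' x (x - a)‖ ^ 2) s / s)
    (ContinuousOn.add (fun s hs =>
      (hasDerivAt_integral_shellIntegral hg₁ (hIoo hs)).continuousAt.continuousWithinAt)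
      (((continuousOn_shellIntegral hg₂).mono hIoo).div continuousOn_id fun s hs => hs.1.ne'))
    (fun φ ψ ε b h hψ hb hbd hψb => by
      rw [← h.setIntegral_eq hm hψ.continuous hb hbd hψb hU hdU hg₁ hg₂,
        ← h.inner_identity hU hf hf'c hfin hsqueeze ((closedBall_subset_ball hbd).trans hdU)]
      exact integral_congr_ae (Filter.Eventually.of_forall fun x => by ring)) s hs
  have hmap : Continuous fun ω : sphere (0 : Em m) 1 => a + s • (ω : Em m) := by fun_prop
  have hmem : ∀ ω : sphere (0 : Em m) 1, a + s • (ω : Em m) ∈ ball a d := fun ω =>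
    add_smul_sphere_mem_ball a ω (hIoo hs)
  have h1 : ∀ t, shellIntegral a (fun x => (2 - m : ℝ) * hsNormSq (f' x)) t =
      (2 - m : ℝ) * shellIntegral a (fun x => hsNormSq (f' x)) t := fun t => by
    simp only [shellIntegral, integral_const_mul]; ring
  have hns : ∀ ω : sphere (0 : Em m) 1, ‖a + s • (ω : Em m) - a‖ ^ 2 = s ^ 2 := fun ω => by
    simp [norm_smul]
  have h2 : shellIntegral a (fun x => ‖x - a‖ ^ 2 * hsNormSq (f' x) - 2 * ‖f' x (x - a)‖ ^ 2) s =
      s ^ 2 * shellIntegral a (fun x => hsNormSq (f' x)) s -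
        2 * shellIntegral a (fun x => ‖f' x (x - a)‖ ^ 2) s := by
    simp only [shellIntegral, hns]
    rw [integral_sub, integral_const_mul, integral_const_mul]
    · ring
    · exact ((hg₀.comp_continuous hmap hmem).integrable_of_hasCompactSupport
        (HasCompactSupport.of_compactSpace _)).const_mul _
    · exact ((hg₃.comp_continuous hmap hmem).integrable_of_hasCompactSupport
        (HasCompactSupport.of_compactSpace _)).const_mul _
  simp only [h1, h2, intervalIntegral.integral_const_mul] at key
  have hs0 : s ≠ 0 := hs.1.ne'
  field_simp at key
  linarith

end Stationary

/-- Cauchy–Schwarz for integrals of inner products of continuous maps on a compact space. -/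
theorem sq_integral_inner_le {Y E : Type*} [TopologicalSpace Y] [CompactSpace Y]
    [MeasurableSpace Y] [OpensMeasurableSpace Y] (μ : Measure Y) [IsFiniteMeasure μ]
    [NormedAddCommGroup E] [InnerProductSpace ℝ E] {u v : Y → E} (hu : Continuous u)
    (hv : Continuous v) :
    (∫ y, ⟪u y, v y⟫ ∂μ) ^ 2 ≤ (∫ y, ‖u y‖ ^ 2 ∂μ) * ∫ y, ‖v y‖ ^ 2 ∂μ := by
  have hint : ∀ {g : Y → ℝ}, Continuous g → Integrable g μ := fun hg =>
    hg.integrable_of_hasCompactSupport (HasCompactSupport.of_compactSpace _)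
  have hquad : ∀ t : ℝ, 0 ≤ (∫ y, ‖u y‖ ^ 2 ∂μ) * (t * t) + (2 * ∫ y, ⟪u y, v y⟫ ∂μ) * t +
      ∫ y, ‖v y‖ ^ 2 ∂μ := by
    intro t
    have h1 : Integrable (fun y => ‖u y‖ ^ 2 * (t * t)) μ := hint (by fun_prop)
    have h2 : Integrable (fun y => 2 * ⟪u y, v y⟫ * t) μ := hint (by fun_prop)
    have h12 : Integrable (fun y => ‖u y‖ ^ 2 * (t * t) + 2 * ⟪u y, v y⟫ * t) μ := h1.add h2
    have h3 : Integrable (fun y => ‖v y‖ ^ 2) μ := hint (by fun_prop)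
    rw [← integral_const_mul, ← integral_mul_const, ← integral_mul_const, ← integral_add h1 h2,
      ← integral_add h12 h3]
    refine integral_nonneg fun y => ?_
    have : ‖t • u y + v y‖ ^ 2 = ‖u y‖ ^ 2 * (t * t) + 2 * ⟪u y, v y⟫ * t + ‖v y‖ ^ 2 := by
      rw [norm_add_sq_real, norm_smul, mul_pow, inner_smul_left, Real.norm_eq_abs, sq_abs]
      simp only [conj_trivial]
      ring
    exact this ▸ sq_nonneg _
  have := discrim_le_zero hquad
  rw [discrim] at this
  linarith

section Height

variable {m : ℕ} {U : Set (Em m)} {f : Em m → ell2} {f' : Em m → (Em m →L[ℝ] ell2)}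
  {a : Em m} {d : ℝ}

theorem sq_shellIntegral_inner_le (hf : ∀ x ∈ U, HasFDerivAt f (f' x) x)
    (hf'c : ContinuousOn f' U) (hdU : ball a d ⊆ U) {s : ℝ} (hs : s ∈ Set.Ioo 0 d) :
    shellIntegral a (fun x => ⟪f' x (x - a), f x⟫) s ^ 2 ≤
      shellIntegral a (fun x => ‖f' x (x - a)‖ ^ 2) s * shellIntegral a (fun x => ‖f x‖ ^ 2) s := by
  have hmap : Continuous fun ω : sphere (0 : Em m) 1 => a + s • (ω : Em m) := by fun_prop
  have hmem : ∀ ω : sphere (0 : Em m) 1, a + s • (ω : Em m) ∈ U := fun ω =>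
    hdU (add_smul_sphere_mem_ball a ω ⟨by linarith [hs.1, hs.2], hs.2⟩)
  have hfc : ContinuousOn f U := fun x hx => (hf x hx).continuousAt.continuousWithinAt
  have h := sq_integral_inner_le (volume : Measure (Em m)).toSphere
    ((continuousOn_radial_apply hf'c a).comp_continuous hmap hmem) (hfc.comp_continuous hmap hmem)
  simp only [shellIntegral]
  rw [mul_pow, mul_mul_mul_comm, ← sq]
  exact mul_le_mul_of_nonneg_left h (sq_nonneg _)

theorem hasDerivAt_shellIntegral_norm_sq (hm : 2 ≤ m) (hf : ∀ x ∈ U, HasFDerivAt f (f' x) x)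
    (hf'c : ContinuousOn f' U) (hdU : ball a d ⊆ U) {s : ℝ} (hs : s ∈ Set.Ioo 0 d) :
    HasDerivAt (shellIntegral a fun x => ‖f x‖ ^ 2)
      ((m - 1) / s * shellIntegral a (fun x => ‖f x‖ ^ 2) s +
        2 / s * shellIntegral a (fun x => ⟪f' x (x - a), f x⟫) s) s := by
  have hs0 : s ≠ 0 := hs.1.ne'
  have hfc : ContinuousOn f U := fun x hx => (hf x hx).continuousAt.continuousWithinAt
  obtain ⟨ρ, hsρ, hρd⟩ := exists_between hs.2
  have hmem : ∀ t ∈ Set.Ioo 0 ρ, ∀ ω : sphere (0 : Em m) 1,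
      a + t • (ω : Em m) ∈ closedBall a ρ := fun t ht ω =>
    ball_subset_closedBall (add_smul_sphere_mem_ball a ω ⟨by linarith [ht.1, ht.2], ht.2⟩)
  have hρU : closedBall a ρ ⊆ U := (closedBall_subset_ball hρd).trans hdU
  have hmap : ∀ t : ℝ, Continuous fun ω : sphere (0 : Em m) 1 => a + t • (ω : Em m) :=
    fun t => by fun_prop
  have hfω : ∀ t ∈ Set.Ioo 0 ρ, Continuous fun ω : sphere (0 : Em m) 1 => f (a + t • (ω : Em m)) :=
    fun t ht => hfc.comp_continuous (hmap t) fun ω => hρU (hmem t ht ω)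
  have hf'ω : ∀ t ∈ Set.Ioo 0 ρ,
      Continuous fun ω : sphere (0 : Em m) 1 => f' (a + t • (ω : Em m)) (ω : Em m) :=
    fun t ht => (hf'c.comp_continuous (hmap t) fun ω => hρU (hmem t ht ω)).clm_apply
      continuous_subtype_val
  obtain ⟨M, hM⟩ := (isCompact_closedBall a ρ).exists_bound_of_continuousOn (hfc.mono hρU)
  obtain ⟨M', hM'⟩ := (isCompact_closedBall a ρ).exists_bound_of_continuousOn (hf'c.mono hρU)
  have hsIoo : s ∈ Set.Ioo 0 ρ := ⟨hs.1, hsρ⟩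
  have hder := (hasDerivAt_integral_of_dominated_loc_of_deriv_le
    (μ := (volume : Measure (Em m)).toSphere)
    (F := fun (t : ℝ) (ω : sphere (0 : Em m) 1) => ‖f (a + t • (ω : Em m))‖ ^ 2)
    (F' := fun (t : ℝ) (ω : sphere (0 : Em m) 1) =>
      2 * ⟪f (a + t • (ω : Em m)), f' (a + t • (ω : Em m)) (ω : Em m)⟫)
    (bound := fun _ => 2 * (M * M')) (isOpen_Ioo.mem_nhds hsIoo)
    (by
      filter_upwards [isOpen_Ioo.mem_nhds hsIoo] with t ht
      exact ((hfω t ht).norm.pow 2).aestronglyMeasurable)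
    (((hfω s hsIoo).norm.pow 2).integrable_of_hasCompactSupport
      (HasCompactSupport.of_compactSpace _))
    (continuous_const.mul ((hfω s hsIoo).inner (hf'ω s hsIoo))).aestronglyMeasurable
    (Filter.Eventually.of_forall fun ω t ht => by
      have h1 := hM _ (hmem t ht ω)
      have h2 : ‖f' (a + t • (ω : Em m)) (ω : Em m)‖ ≤ M' := by
        have := (f' (a + t • (ω : Em m))).le_opNorm (ω : Em m)
        rw [norm_eq_of_mem_sphere, mul_one] at this
        exact this.trans (hM' _ (hmem t ht ω))
      rw [norm_mul, Real.norm_two]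
      gcongr
      exact (norm_inner_le_norm _ _).trans
        (mul_le_mul h1 h2 (norm_nonneg _) ((norm_nonneg _).trans h1)))
    (integrable_const _)
    (Filter.Eventually.of_forall fun ω t ht => by
      have h1 : HasDerivAt (fun t : ℝ => a + t • (ω : Em m)) (ω : Em m) t := by
        simpa using ((hasDerivAt_id t).smul_const (ω : Em m)).const_add a
      exact ((hf _ (hρU (hmem t ht ω))).comp_hasDerivAt t h1).norm_sq)).2
  have hpow : HasDerivAt (fun t : ℝ => t ^ (m - 1)) ((m - 1) / s * s ^ (m - 1)) s := by
    refine (hasDerivAt_pow (m - 1) s).congr_deriv ?_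
    obtain ⟨k, rfl⟩ : ∃ k, m = k + 2 := ⟨m - 2, by omega⟩
    have e1 : k + 2 - 1 = k + 1 := rfl
    rw [e1, Nat.add_sub_cancel, pow_succ]
    push_cast
    field_simp
    ring
  refine (hpow.mul hder).congr_deriv ?_
  have hin : ∀ ω : sphere (0 : Em m) 1,
      ⟪f' (a + s • (ω : Em m)) (a + s • (ω : Em m) - a), f (a + s • (ω : Em m))⟫ =
        s / 2 * (2 * ⟪f (a + s • (ω : Em m)), f' (a + s • (ω : Em m)) (ω : Em m)⟫) := fun ω => by
    rw [add_sub_cancel_left, map_smul, inner_smul_left, real_inner_comm]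
    simp only [conj_trivial]
    ring
  simp only [shellIntegral, hin, integral_const_mul]
  field_simp

end Height

/-- (Almgren frequency monotonicity.) For `f` squeeze and squash
stationary, the frequency `N_a(ρ) = ρ·D_a(ρ)/H_a(ρ)` is differentiable with
nonnegative derivative at every radius where `H_a > 0`, and is nondecreasing on any
interval contained in `{ρ ∈ (0, dist(a,∁U)) : H_a(ρ) > 0}`. -/
theorem stmt12 (m : ℕ) (hm : 2 ≤ m) (U : Set (Em m)) (hU : IsOpen U)
    (f : Em m → ell2) (f' : Em m → (Em m →L[ℝ] ell2))
    (hf : ∀ x ∈ U, HasFDerivAt f (f' x) x) (hf'c : ContinuousOn f' U)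
    (hfin : IntegrableOn (fun x => hsNormSq (f' x)) U volume)
    (hsqueeze : SqueezeStationary U f) (hsquash : SquashStationary U f)
    (a : Em m) (ha : a ∈ U) :
    (∀ r ∈ Set.Ioo (0 : ℝ) (Metric.infDist a Uᶜ),
      0 < (∫ x in Metric.sphere a r, ‖f x‖ ^ 2 ∂(μH[((m : ℝ) - 1)])) →
      ∃ N' : ℝ, 0 ≤ N' ∧
        HasDerivAt
          (fun ρ : ℝ => ρ * (∫ x in Metric.ball a ρ, hsNormSq (f' x)) /
            ∫ x in Metric.sphere a ρ, ‖f x‖ ^ 2 ∂(μH[((m : ℝ) - 1)]))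
          N' r) ∧
    (∀ I : Set ℝ, I.OrdConnected →
      I ⊆ {r ∈ Set.Ioo (0 : ℝ) (Metric.infDist a Uᶜ) |
        0 < ∫ x in Metric.sphere a r, ‖f x‖ ^ 2 ∂(μH[((m : ℝ) - 1)])} →
      MonotoneOn
        (fun ρ : ℝ => ρ * (∫ x in Metric.ball a ρ, hsNormSq (f' x)) /
          ∫ x in Metric.sphere a ρ, ‖f x‖ ^ 2 ∂(μH[((m : ℝ) - 1)])) I) := by
  set d := Metric.infDist a Uᶜ
  have hdU : ball a d ⊆ U := ball_infDist_compl_subset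
  obtain ⟨c, hc, hsphere⟩ := exists_setIntegral_sphere_eq hm
  have hfc : ContinuousOn f U := fun x hx => (hf x hx).continuousAt.continuousWithinAt
  have hH : ∀ ρ ∈ Set.Ioo 0 d, ∫ x in sphere a ρ, ‖f x‖ ^ 2 ∂(μH[((m : ℝ) - 1)]) =
      c * shellIntegral a (fun x => ‖f x‖ ^ 2) ρ := fun ρ hρ =>
    hsphere _ a ρ hρ.1 ((hfc.mono ((sphere_subset_ball hρ.2).trans hdU)).norm.pow 2)
  have hgc : ContinuousOn (fun x => hsNormSq (f' x)) (ball a d) := hf'c.hsNormSq.mono hdU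
  have hderiv : ∀ r ∈ Set.Ioo (0 : ℝ) d,
      0 < (∫ x in Metric.sphere a r, ‖f x‖ ^ 2 ∂(μH[((m : ℝ) - 1)])) →
      ∃ N' : ℝ, 0 ≤ N' ∧
        HasDerivAt
          (fun ρ : ℝ => ρ * (∫ x in Metric.ball a ρ, hsNormSq (f' x)) /
            ∫ x in Metric.sphere a ρ, ‖f x‖ ^ 2 ∂(μH[((m : ℝ) - 1)]))
          N' r := by
    intro r hr hpos
    rw [hH r hr] at hpos
    have hc0 : 0 < c := hc.lt_of_ne fun h => by simp [← h] at hpos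
    have hH0 : 0 < shellIntegral a (fun x => ‖f x‖ ^ 2) r := pos_of_mul_pos_right hpos hc
    have hr0 : 0 < r := hr.1
    have hD := hasDerivAt_integral_shellIntegral hgc
      (⟨by linarith [hr.1, hr.2], hr.2⟩ : r ∈ Set.Ioo (-d) d)
    have hHd := hasDerivAt_shellIntegral_norm_sq hm hf hf'c hdU hr
    have hcs := sq_shellIntegral_inner_le hf hf'c hdU hr
    have hout := hsquash.mul_energy_eq hm hU hf hf'c hfin hdU hr
    have hinn := hsqueeze.sq_mul_shellIntegral_eq hm hU hf hf'c hfin hdU hr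
    have hN := ((hasDerivAt_id r).mul hD).div (hHd.const_mul c) hpos.ne'
    refine ⟨_, ?_, hN.congr_of_eventuallyEq ?_⟩
    · rw [← hout] at hcs ⊢
      refine div_nonneg ?_ (sq_nonneg _)
      simp only [id_eq, Pi.mul_apply]
      generalize shellIntegral a (fun x => ‖f x‖ ^ 2) r = H at *
      generalize shellIntegral a (fun x => ‖f' x (x - a)‖ ^ 2) r = Q at *
      generalize (∫ t in (0 : ℝ)..r, shellIntegral a (fun x => hsNormSq (f' x)) t) = D at *
      generalize shellIntegral a (fun x => hsNormSq (f' x)) r = F at *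
      have hF : F = ((m - 2) * (r * D) + 2 * Q) / r ^ 2 := by field_simp; linarith
      have : (1 * D + r * F) * (c * H) - r * D * (c * ((m - 1) / r * H + 2 / r * (r * D))) =
          2 * c / r * (Q * H - (r * D) ^ 2) := by
        rw [hF]; field_simp; ring
      rw [this]
      exact mul_nonneg (by positivity) (by linarith)
    · filter_upwards [isOpen_Ioo.mem_nhds hr] with ρ hρ
      rw [hH ρ hρ, setIntegral_ball_eq hm hρ.1.le hρ.2 hgc]
      rfl
  refine ⟨hderiv, fun I hI hsub => ?_⟩
  choose! N' hN'0 hN' using hderiv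
  refine monotoneOn_of_deriv_nonneg hI.convex
    (fun r hr => (hN' r (hsub hr).1 (hsub hr).2).continuousAt.continuousWithinAt)
    (fun r hr => ?_) fun r hr => ?_
  · have hr := interior_subset hr
    exact (hN' r (hsub hr).1 (hsub hr).2).differentiableAt.differentiableWithinAt
  · have hr := interior_subset hr
    rw [(hN' r (hsub hr).1 (hsub hr).2).deriv]
    exact hN'0 r (hsub hr).1 (hsub hr).2
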